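/- Let A = ℂQ/⟨R⟩ be a connected, acyclic, tame bound quiver algebra and α ∈ ℕ^{Q_0} with P_A(α) ≠ ∅, and let C(α) = closure(C(α_1) ⊕ … ⊕ C(α_l)) be the generic decomposition of C(α). Then the number of generic parameters μ_g(C(α)) equals the number t of indices i ∈ {1,…,l} (counted with multiplicity) for which C(α_i) is not an orbit closure. -/

import Mathlib

open Matrix
noncomputable section

/-- A (finite-vertex) quiver: vertices, arrows, tail and head maps. -/
structure Quiv where
  V : Type
  A : Type
  t : A → V
  h : A → V
  [fV : Fintype V]
  [dV : DecidableEq V]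

attribute [instance] Quiv.fV Quiv.dV

/-- The `Quiver` structure on the vertices of `Q`: an arrow from `x` to `y` is an
arrow of `Q` with tail `x` and head `y`.  This gives us `Quiver.Path x y`, the type of
oriented paths from `x` to `y` in `Q`. -/
instance quivToQuiver (Q : Quiv) : Quiver Q.V := ⟨fun x y => {a : Q.A // Q.t a = x ∧ Q.h a = y}⟩

/-- The space of matrix representations of `Q` of dimension vector `β`, with entries in a
commutative ring `R`. -/
def RepR (Q : Quiv) (R : Type) (β : Q.V → ℕ) := ∀ a : Q.A, Matrix (Fin (β (Q.h a))) (Fin (β (Q.t a))) R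

/-- The representation space `rep(Q,β) = ∏_{a ∈ Q₁} ℂ^{β(ha) × β(ta)}`. -/
abbrev QRep (Q : Quiv) (β : Q.V → ℕ) := RepR Q ℂ β

/-- Transport of a rectangular matrix along equalities of its sizes. -/
def castM {R : Type} {m n m' n' : ℕ} (hm : m = m') (hn : n = n')
    (M : Matrix (Fin m) (Fin n) R) : Matrix (Fin m') (Fin n') R :=
  M.submatrix (Fin.cast hm.symm) (Fin.cast hn.symm)

/-- The value `W(p)` of a representation `W` on an oriented path `p` (the product of the
matrices attached to the arrows of `p`; the trivial path gives the identity matrix). -/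
def evalPath {Q : Quiv} {R : Type} [CommRing R] {β : Q.V → ℕ} (W : RepR Q R β) :
    ∀ {x y : Q.V}, Quiver.Path x y → Matrix (Fin (β y)) (Fin (β x)) R
  | _, _, Quiver.Path.nil => 1
  | _, _, Quiver.Path.cons p e =>
      (castM (congrArg β e.2.2) (congrArg β e.2.1) (W e.1)) * evalPath W p
variable (Q : Quiv)

/-- A formal (finite) linear combination of parallel oriented paths in `Q`, together with its
endpoints: the element of the path algebra it represents lives in `e_y · ℂQ · e_x`. -/
def FormalRel := Σ (x : Q.V) (y : Q.V), (Quiver.Path x y →₀ ℂ)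

variable {Q}

/-- Evaluation of a representation on a formal linear combination of parallel paths. -/
def evalLin {β : Q.V → ℕ} (W : QRep Q β) {x y : Q.V} (c : Quiver.Path x y →₀ ℂ) :
    Matrix (Fin (β y)) (Fin (β x)) ℂ :=
  c.sum fun p k => k • evalPath W p

/-- Evaluation of a representation over `ℂ[x]` on a formal linear combination of paths. -/
def evalLinP {β : Q.V → ℕ} (W : RepR Q (Polynomial ℂ) β) {x y : Q.V}
    (c : Quiver.Path x y →₀ ℂ) : Matrix (Fin (β y)) (Fin (β x)) (Polynomial ℂ) :=
  c.sum fun p k => (Polynomial.C k) • evalPath W p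

/-- The module variety `mod(A,β)` of the algebra `A = ℂQ/⟨S⟩`: all `β`-dimensional
representations of `Q` annihilating every relation in `S`. -/
def modSet (S : Set (FormalRel Q)) (β : Q.V → ℕ) : Set (QRep Q β) :=
  {W | ∀ r ∈ S, evalLin W r.2.2 = 0}

/-- A set of relations is admissible if every path occurring in it has length at least two. -/
def AdmissibleRels (S : Set (FormalRel Q)) : Prop :=
  ∀ r ∈ S, ∀ p ∈ r.2.2.support, 2 ≤ p.length

/-- The base change group `GL(β) = ∏_x GL(β(x),ℂ)`. -/
abbrev GLb (β : Q.V → ℕ) := ∀ x : Q.V, Matrix.GeneralLinearGroup (Fin (β x)) ℂ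

/-- The action of `GL(β)` on `rep(Q,β)` by simultaneous conjugation. -/
def gAct {β : Q.V → ℕ} (g : GLb β) (W : QRep Q β) : QRep Q β :=
  fun a => ((g (Q.h a)).val) * W a * (((g (Q.t a))⁻¹).val)

/-- The character of `GL(β)` induced by the weight `σ`: `g ↦ ∏_x det(g(x))^{σ(x)}`.  -/
def chi {β : Q.V → ℕ} (σ : Q.V → ℤ) (g : GLb β) : ℂ :=
  ∏ x : Q.V, ((g x).val.det) ^ (σ x)

/-- Index type of the coordinates on `rep(Q,β)`. -/
def RepCoord (β : Q.V → ℕ) := Σ a : Q.A, Fin (β (Q.h a)) × Fin (β (Q.t a))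

/-- The coordinates of a point of `rep(Q,β)`. -/
def repCoords {β : Q.V → ℕ} (W : QRep Q β) : RepCoord (Q := Q) β → ℂ :=
  fun c => W c.1 c.2.1 c.2.2

/-- `F` is a polynomial function on `rep(Q,β)`. -/
def IsPolyFun {β : Q.V → ℕ} (F : QRep Q β → ℂ) : Prop :=
  ∃ P : MvPolynomial (RepCoord (Q := Q) β) ℂ, ∀ W, F W = MvPolynomial.eval (repCoords W) P

/-- `F` is a semi-invariant of weight `σ` on `rep(Q,β)`. -/
def IsSemiInvariant {β : Q.V → ℕ} (σ : Q.V → ℤ) (F : QRep Q β → ℂ) : Prop :=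
  IsPolyFun F ∧ ∀ (g : GLb β) (W : QRep Q β), F (gAct g W) = chi σ g * F W

/-- The orbit semigroup `S_Q(W)` of a representation `W ∈ rep(Q,β)`: all weights `σ` admitting
a semi-invariant of weight `σ` not vanishing at `W`. -/
def OrbitSemigroup {β : Q.V → ℕ} (W : QRep Q β) : Set (Q.V → ℤ) :=
  {σ | ∃ F : QRep Q β → ℂ, IsSemiInvariant σ F ∧ F W ≠ 0}

/-- `W` is `σ`-semi-stable: some positive multiple of `σ` lies in the orbit semigroup. -/
def SemiStable {β : Q.V → ℕ} (σ : Q.V → ℤ) (W : QRep Q β) : Prop :=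
  ∃ n : ℕ, 1 ≤ n ∧ (fun x => (n : ℤ) * σ x) ∈ OrbitSemigroup W

/-- The weight `σ` is `W`-saturated: if `nσ` lies in the orbit semigroup of `W` for some
integer `n ≥ 1`, then so does `σ`. -/
def WSaturated {β : Q.V → ℕ} (W : QRep Q β) (σ : Q.V → ℤ) : Prop :=
  (∃ n : ℕ, 1 ≤ n ∧ (fun x => (n : ℤ) * σ x) ∈ OrbitSemigroup W) → σ ∈ OrbitSemigroup W

/-- `Q` is connected: any two vertices are joined by an unoriented walk. -/
def QConnected (Q : Quiv) : Prop :=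
  ∀ x y : Q.V, Relation.ReflTransGen
    (fun u v => ∃ a : Q.A, (Q.t a = u ∧ Q.h a = v) ∨ (Q.t a = v ∧ Q.h a = u)) x y

/-- `Q` is acyclic: the only oriented path from a vertex to itself is the trivial one. -/
def QAcyclic (Q : Quiv) : Prop := ∀ (x : Q.V) (p : Quiver.Path x x), p = Quiver.Path.nil
section Capacity

variable (Q : Quiv) (β : Q.V → ℕ) (σ : Q.V → ℤ)

/-- Vertices where the weight `σ` is positive. -/
abbrev PosV := {x : Q.V // 0 < σ x}

/-- Vertices where the weight `σ` is negative. -/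
abbrev NegV := {x : Q.V // σ x < 0}

/-- `σ₊` at a positive vertex. -/
abbrev posP (i : PosV Q σ) : ℕ := (σ i.1).toNat

/-- `σ₋` at a negative vertex. -/
abbrev negP (j : NegV Q σ) : ℕ := (-σ j.1).toNat

/-- Row index type of the `N × N` block matrices: block rows are indexed by pairs `(j,q)`
with `q ∈ I_j⁻`, each of height `β(w_j)`; so `N = Σ_j σ₋(w_j)β(w_j)` rows in total. -/
abbrev RowT := Σ j : NegV Q σ, Fin (negP Q σ j) × Fin (β j.1)

/-- Column index type of the `N × N` block matrices: block columns indexed by pairs `(i,r)`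
with `r ∈ I_i⁺`, each of width `β(v_i)`; so `N = Σ_i σ₊(v_i)β(v_i)` columns in total. -/
abbrev ColT := Σ i : PosV Q σ, Fin (posP Q σ i) × Fin (β i.1)

/-- The index set `I_σ = {(i,j,p,q,r)}`. -/
structure BIdx where
  i : PosV Q σ
  j : NegV Q σ
  p : Quiver.Path i.1 j.1
  q : Fin (negP Q σ j)
  r : Fin (posP Q σ i)

variable {Q β σ}

/-- The block matrix `W^{i,j,p}_{q,r}`: its `(q,r)` block entry is `W(p)` and all other
entries vanish. -/
def blockMat (W : QRep Q β) (d : BIdx Q σ) : Matrix (RowT Q β σ) (ColT Q β σ) ℂ :=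
  fun s u =>
    if hj : s.1 = d.j then
      if hi : u.1 = d.i then
        if Fin.cast (congrArg (negP Q σ) hj) s.2.1 = d.q ∧
           Fin.cast (congrArg (posP Q σ) hi) u.2.1 = d.r then
          evalPath W d.p (Fin.cast (congrArg (fun z => β z.1) hj) s.2.2)
            (Fin.cast (congrArg (fun z => β z.1) hi) u.2.2)
        else 0
      else 0
    else 0

/-- The Brascamp–Lieb (completely positive) operator `T_{W,σ}` associated to the quiver
datum `(W,σ)`, with Kraus operators the block matrices `W^{i,j,p}_{q,r}`. -/
def BLop (W : QRep Q β) (X : Matrix (RowT Q β σ) (RowT Q β σ) ℂ) :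
    Matrix (ColT Q β σ) (ColT Q β σ) ℂ :=
  ∑ᶠ d : BIdx Q σ, (blockMat W d)ᵀ * X * blockMat W d

/-- The capacity `cap_Q(W,σ)` of the quiver datum `(W,σ)`: the infimum of
`Det (T_{W,σ}(X))` over real positive definite matrices `X` with `Det X = 1`. -/
def capQ (W : QRep Q β) : ℝ :=
  sInf {r : ℝ | ∃ X : Matrix (RowT Q β σ) (RowT Q β σ) ℝ, X.PosDef ∧ X.det = 1 ∧
    r = ((BLop (σ := σ) W (X.map Complex.ofReal)).det).re}

/-- `Span_ℂ(W^{i,j,p}_{q,r} : (i,j,p,q,r) ∈ I_σ)` contains a non-singular `N × N` matrix. -/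
def SpanNonsingular (W : QRep Q β) (σ : Q.V → ℤ) : Prop :=
  ∃ M ∈ Submodule.span ℂ (Set.range (blockMat (σ := σ) W)),
    Function.Bijective (Matrix.mulVecLin M)

end Capacity
section HomExt

variable {Q : Quiv}

/-- The space of morphisms of representations `Hom(V,W)`, as a subspace of
`∏_x Hom(V(x),W(x))` (in matrix form). -/
def HomS {α γ : Q.V → ℕ} (V : QRep Q α) (W : QRep Q γ) :
    Submodule ℂ (∀ x : Q.V, Matrix (Fin (γ x)) (Fin (α x)) ℂ) where
  carrier := {φ | ∀ a : Q.A, φ (Q.h a) * V a = W a * φ (Q.t a)}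
  add_mem' := by
    intro φ ψ hφ hψ a
    simp only [Pi.add_apply, Matrix.add_mul, Matrix.mul_add, hφ a, hψ a]
  zero_mem' := by intro a; simp
  smul_mem' := by
    intro c φ hφ a
    simp only [Pi.smul_apply, Matrix.smul_mul, Matrix.mul_smul, hφ a]

/-- `dim_ℂ Hom(V,W)`. -/
def dimHom {α γ : Q.V → ℕ} (V : QRep Q α) (W : QRep Q γ) : ℕ :=
  Module.finrank ℂ (HomS V W)

/-- A family of matrices is componentwise surjective (as linear maps). -/
def MorSurj {α γ : Q.V → ℕ} (φ : ∀ x : Q.V, Matrix (Fin (γ x)) (Fin (α x)) ℂ) : Prop :=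
  ∀ x, Function.Surjective (Matrix.mulVecLin (φ x))

/-- A family of matrices is componentwise injective (as linear maps). -/
def MorInj {α γ : Q.V → ℕ} (φ : ∀ x : Q.V, Matrix (Fin (γ x)) (Fin (α x)) ℂ) : Prop :=
  ∀ x, Function.Injective (Matrix.mulVecLin (φ x))

/-- Isomorphism of representations (possibly of different dimension vectors). -/
def RIso {α γ : Q.V → ℕ} (V : QRep Q α) (W : QRep Q γ) : Prop :=
  ∃ u : ∀ x : Q.V, ((Fin (α x) → ℂ) ≃ₗ[ℂ] (Fin (γ x) → ℂ)),
    ∀ a : Q.A, (u (Q.h a)).toLinearMap ∘ₗ (V a).mulVecLin =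
      (W a).mulVecLin ∘ₗ (u (Q.t a)).toLinearMap

/-- The space of `1`-cochains from `V` to `W`: families `φ(a) : V(ta) → W(ha)`. -/
abbrev C1sp (α γ : Q.V → ℕ) := ∀ a : Q.A, Matrix (Fin (γ (Q.h a))) (Fin (α (Q.t a))) ℂ

/-- The derivative (Leibniz rule) of a path with respect to a `1`-cochain `φ`:
`D_{a_s ⋯ a_1}(φ) = Σ_k W(a_s ⋯ a_{k+1}) φ(a_k) V(a_{k-1} ⋯ a_1)`. -/
def der {α γ : Q.V → ℕ} (V : QRep Q α) (W : QRep Q γ) (φ : C1sp (Q := Q) α γ) :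
    ∀ {x y : Q.V}, Quiver.Path x y → Matrix (Fin (γ y)) (Fin (α x)) ℂ
  | _, _, Quiver.Path.nil => 0
  | _, _, Quiver.Path.cons p e =>
      castM (congrArg γ e.2.2) (congrArg α e.2.1) (φ e.1) * evalPath V p
      + castM (congrArg γ e.2.2) (congrArg γ e.2.1) (W e.1) * der V W φ p

lemma der_add {α γ : Q.V → ℕ} (V : QRep Q α) (W : QRep Q γ) (φ ψ : C1sp (Q := Q) α γ)
    {x y : Q.V} (p : Quiver.Path x y) :
    der V W (φ + ψ) p = der V W φ p + der V W ψ p := by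
  induction p with
  | nil => simp [der]
  | cons p e ih =>
      simp only [der, ih, Pi.add_apply, castM, Matrix.submatrix_add, Matrix.add_mul,
        Matrix.mul_add]
      abel

lemma der_smul {α γ : Q.V → ℕ} (V : QRep Q α) (W : QRep Q γ) (c : ℂ) (φ : C1sp (Q := Q) α γ)
    {x y : Q.V} (p : Quiver.Path x y) :
    der V W (c • φ) p = c • der V W φ p := by
  induction p with
  | nil => simp [der]
  | cons p e ih =>
      simp only [der, ih, Pi.smul_apply, castM, Matrix.submatrix_smul, Matrix.smul_mul,
        Matrix.mul_smul, smul_add]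

lemma der_zero {α γ : Q.V → ℕ} (V : QRep Q α) (W : QRep Q γ)
    {x y : Q.V} (p : Quiver.Path x y) :
    der V W (0 : C1sp (Q := Q) α γ) p = 0 := by
  induction p with
  | nil => simp [der]
  | cons p e ih =>
      simp [der, ih, castM]

/-- The derivative of a formal linear combination of parallel paths. -/
def derRel {α γ : Q.V → ℕ} (V : QRep Q α) (W : QRep Q γ) (φ : C1sp (Q := Q) α γ)
    {x y : Q.V} (c : Quiver.Path x y →₀ ℂ) : Matrix (Fin (γ y)) (Fin (α x)) ℂ :=
  c.sum fun p k => k • der V W φ p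

/-- The space of `1`-cocycles relative to the set of relations `S`: cochains whose
derivative kills every relation in `S`. -/
def Z1 (S : Set (FormalRel Q)) {α γ : Q.V → ℕ} (V : QRep Q α) (W : QRep Q γ) :
    Submodule ℂ (C1sp (Q := Q) α γ) where
  carrier := {φ | ∀ r ∈ S, derRel V W φ r.2.2 = 0}
  add_mem' := by
    intro φ ψ hφ hψ r hr
    have : derRel V W (φ + ψ) r.2.2 = derRel V W φ r.2.2 + derRel V W ψ r.2.2 := by
      simp only [derRel, der_add, smul_add]
      exact Finsupp.sum_add
    rw [this, hφ r hr, hψ r hr, add_zero]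
  zero_mem' := by
    intro r hr
    simp [derRel, der_zero]
  smul_mem' := by
    intro c φ hφ r hr
    have : derRel V W (c • φ) r.2.2 = c • derRel V W φ r.2.2 := by
      simp only [derRel, der_smul, Finsupp.smul_sum, smul_comm c]
    rw [this, hφ r hr, smul_zero]

/-- The coboundary map `d⁰ : ∏_x Hom(V(x),W(x)) → C¹`,
`f ↦ (a ↦ f(ha) V(a) − W(a) f(ta))`. -/
def d0map {α γ : Q.V → ℕ} (V : QRep Q α) (W : QRep Q γ) :
    (∀ x : Q.V, Matrix (Fin (γ x)) (Fin (α x)) ℂ) →ₗ[ℂ] C1sp (Q := Q) α γ where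
  toFun f := fun a => f (Q.h a) * V a - W a * f (Q.t a)
  map_add' f g := by
    funext a
    simp only [Pi.add_apply, Matrix.add_mul, Matrix.mul_add]
    abel
  map_smul' c f := by
    funext a
    simp only [Pi.smul_apply, Matrix.smul_mul, Matrix.mul_smul, smul_sub, RingHom.id_apply]

/-- The space of `1`-coboundaries. -/
def B1 {α γ : Q.V → ℕ} (V : QRep Q α) (W : QRep Q γ) : Submodule ℂ (C1sp (Q := Q) α γ) :=
  LinearMap.range (d0map V W)

/-- `dim_ℂ Ext¹(V,W)` over the algebra `ℂQ/⟨S⟩`, computed as the dimension of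
`Z¹/B¹` (for modules, `B¹ ⊆ Z¹`, so this is `dim Z¹ − dim B¹`). -/
def dimExt1 (S : Set (FormalRel Q)) {α γ : Q.V → ℕ} (V : QRep Q α) (W : QRep Q γ) : ℕ :=
  Module.finrank ℂ (Z1 S V W) - Module.finrank ℂ ↥((B1 V W) ⊓ (Z1 S V W))

end HomExt
section ProjPdim

variable {Q : Quiv}

/-- `P` is a projective module over `ℂQ/⟨S⟩` (in matrix-representation form):
every morphism from `P` to the target of a surjection of modules lifts. -/
def IsProjRep (S : Set (FormalRel Q)) {γ : Q.V → ℕ} (P : QRep Q γ) : Prop :=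
  ∀ (δ ε : Q.V → ℕ) (M : QRep Q δ) (N : QRep Q ε), M ∈ modSet S δ → N ∈ modSet S ε →
    ∀ g ∈ HomS M N, MorSurj g → ∀ f ∈ HomS P N,
      ∃ h ∈ HomS P M, ∀ x, g x * h x = f x

/-- `V` has projective dimension at most one over `ℂQ/⟨S⟩`: there is a short exact
sequence `0 → P₁ → P₀ → V → 0` with `P₀, P₁` projective. -/
def PdimLE1 (S : Set (FormalRel Q)) {β : Q.V → ℕ} (V : QRep Q β) : Prop :=
  ∃ (γ₀ γ₁ : Q.V → ℕ) (P₀ : QRep Q γ₀) (P₁ : QRep Q γ₁),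
    P₀ ∈ modSet S γ₀ ∧ P₁ ∈ modSet S γ₁ ∧ IsProjRep S P₀ ∧ IsProjRep S P₁ ∧
    ∃ i ∈ HomS P₁ P₀, ∃ p ∈ HomS P₀ V, MorInj i ∧ MorSurj p ∧
      ∀ x, LinearMap.range (Matrix.mulVecLin (i x)) = LinearMap.ker (Matrix.mulVecLin (p x))

/-- The set `P_A(α) = {V ∈ mod(A,α) : pdim_A V ≤ 1}` where `A = ℂQ/⟨S⟩`. -/
def PAset (S : Set (FormalRel Q)) (α : Q.V → ℕ) : Set (QRep Q α) :=
  {V | V ∈ modSet S α ∧ PdimLE1 S V}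

end ProjPdim

section Zariski

/-- The Zariski topology on the affine space `ι → ℂ`: generated by the complements of
hypersurfaces. -/
def zarPi (ι : Type) : TopologicalSpace (ι → ℂ) :=
  TopologicalSpace.generateFrom
    {U | ∃ p : MvPolynomial ι ℂ, U = {w | MvPolynomial.eval w p ≠ 0}}

variable {Q : Quiv}

/-- The Zariski topology on `rep(Q,β)`. -/
def zarTop (β : Q.V → ℕ) : TopologicalSpace (QRep Q β) :=
  TopologicalSpace.induced (repCoords (β := β)) (zarPi _)

/-- Zariski closure in `rep(Q,β)`. -/
def zclosure {β : Q.V → ℕ} (s : Set (QRep Q β)) : Set (QRep Q β) :=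
  @closure _ (zarTop β) s

/-- Zariski-open. -/
def zIsOpen {β : Q.V → ℕ} (s : Set (QRep Q β)) : Prop := @IsOpen _ (zarTop β) s

/-- Zariski-closed. -/
def zIsClosed {β : Q.V → ℕ} (s : Set (QRep Q β)) : Prop := @IsClosed _ (zarTop β) s

/-- Irreducibility in the Zariski topology. -/
def zIrred {β : Q.V → ℕ} (s : Set (QRep Q β)) : Prop := @IsIrreducible _ (zarTop β) s

/-- Dimension of a subset of `rep(Q,β)`: the topological Krull dimension in the
(subspace) Zariski topology. -/
def zdim {β : Q.V → ℕ} (s : Set (QRep Q β)) : WithBot ℕ∞ :=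
  @topologicalKrullDim s (TopologicalSpace.induced Subtype.val (zarTop β))

/-- `C(α)`: the closure of `P_A(α)`. -/
def Cset (S : Set (FormalRel Q)) (α : Q.V → ℕ) : Set (QRep Q α) := zclosure (PAset S α)

/-- `C` is an irreducible component of `M` (for `M` closed in `rep(Q,α)`): a maximal
irreducible closed subset of `M`. -/
def IsIrrCompOf {β : Q.V → ℕ} (C M : Set (QRep Q β)) : Prop :=
  zIrred C ∧ zIsClosed C ∧ C ⊆ M ∧
    ∀ C' : Set (QRep Q β), zIrred C' → zIsClosed C' → C' ⊆ M → C ⊆ C' → C' = C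

/-- `V` is an indecomposable representation: it is nonzero and its endomorphism algebra
has no idempotents other than `0` and `1`. -/
def IsIndecRep {α : Q.V → ℕ} (V : QRep Q α) : Prop :=
  (∃ x, α x ≠ 0) ∧
  ∀ φ ∈ HomS V V, (∀ x, φ x * φ x = φ x) → φ = 0 ∨ φ = fun x => (1 : Matrix _ _ ℂ)

/-- `C` is an indecomposable irreducible component of `M`: an irreducible component
containing a dense open subset of indecomposable representations. -/
def IsIndecComp {β : Q.V → ℕ} (C M : Set (QRep Q β)) : Prop :=
  IsIrrCompOf C M ∧
  ∃ U : Set (QRep Q β), zIsOpen U ∧ C ⊆ zclosure (C ∩ U) ∧ ∀ V ∈ C ∩ U, IsIndecRep V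

/-- The `GL(α)`-orbit of `V`. -/
def orbitOf {α : Q.V → ℕ} (V : QRep Q α) : Set (QRep Q α) := {W | ∃ g : GLb α, gAct g V = W}

/-- `C` is an orbit closure `closure(GL(α)·V)` of some module `V ∈ mod(A,α)`. -/
def IsOrbitClosure (S : Set (FormalRel Q)) {α : Q.V → ℕ} (C : Set (QRep Q α)) : Prop :=
  ∃ V ∈ modSet S α, C = zclosure (orbitOf V)

/-- The coordinates on `∏_x ℂ^{α(x) × α(x)}`, the ambient space of `GL(α)`. -/
def glCoords {α : Q.V → ℕ} (g : ∀ x : Q.V, Matrix (Fin (α x)) (Fin (α x)) ℂ) :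
    (Σ x : Q.V, Fin (α x) × Fin (α x)) → ℂ := fun c => g c.1 c.2.1 c.2.2

/-- The Zariski topology on `∏_x ℂ^{α(x) × α(x)}`. -/
def glTop (Q : Quiv) (α : Q.V → ℕ) :
    TopologicalSpace (∀ x : Q.V, Matrix (Fin (α x)) (Fin (α x)) ℂ) :=
  TopologicalSpace.induced glCoords (zarPi _)

/-- `GL(α)` as a (quasi-affine) subset of `∏_x ℂ^{α(x) × α(x)}`. -/
def glSet (Q : Quiv) (α : Q.V → ℕ) : Set (∀ x : Q.V, Matrix (Fin (α x)) (Fin (α x)) ℂ) :=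
  {g | ∀ x, IsUnit (g x)}

/-- The dimension of the group variety `GL(α)`. -/
def glDim (Q : Quiv) (α : Q.V → ℕ) : WithBot ℕ∞ :=
  @topologicalKrullDim (glSet Q α) (TopologicalSpace.induced Subtype.val (glTop Q α))

end Zariski
section Sums

variable {Q : Quiv}

/-- `W` is a direct sum of the representations `V i` (up to isomorphism of the underlying
block-diagonal structure). -/
def IsSumOf {ι : Type} [Fintype ι] [DecidableEq ι] {αs : ι → Q.V → ℕ} {δ : Q.V → ℕ}
    (W : QRep Q δ) (V : ∀ i, QRep Q (αs i)) : Prop :=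
  ∃ u : ∀ x : Q.V, ((Fin (δ x) → ℂ) ≃ₗ[ℂ] ((Σ i, Fin (αs i x)) → ℂ)),
    ∀ a : Q.A, (u (Q.h a)).toLinearMap ∘ₗ (W a).mulVecLin =
      (Matrix.blockDiagonal' (fun i => V i a)).mulVecLin ∘ₗ (u (Q.t a)).toLinearMap

/-- The constructible subset `C₁ ⊕ ⋯ ⊕ C_l ⊆ rep(Q,δ)`: representations isomorphic to a
direct sum `V₁ ⊕ ⋯ ⊕ V_l` with `V_i ∈ C_i`. -/
def sumSet {ι : Type} [Fintype ι] [DecidableEq ι] (αs : ι → Q.V → ℕ)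
    (Cs : ∀ i, Set (QRep Q (αs i))) (δ : Q.V → ℕ) : Set (QRep Q δ) :=
  {W | ∃ V : ∀ i, QRep Q (αs i), (∀ i, V i ∈ Cs i) ∧ IsSumOf W V}

/-- The generic `Ext¹` between two subsets:
`ext¹(C,D) = min {dim Ext¹(X,Y) : (X,Y) ∈ C × D}`. -/
def genExt1 (S : Set (FormalRel Q)) {α α' : Q.V → ℕ}
    (C : Set (QRep Q α)) (D : Set (QRep Q α')) : ℕ :=
  sInf {n : ℕ | ∃ X ∈ C, ∃ Y ∈ D, n = dimExt1 S X Y}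

end Sums

section ExtHigher

variable {Q : Quiv}

/-- A representation of `Q` packaged with its dimension vector. -/
def PRp (Q : Quiv) := Σ γ : Q.V → ℕ, QRep Q γ

instance : Inhabited (PRp Q) := ⟨⟨fun _ => 0, fun _ => 0⟩⟩

/-- `K` is a (first) syzygy of `M` over `ℂQ/⟨S⟩`: there is a short exact sequence
`0 → K → P → M → 0` with `P` a projective module. -/
def IsSyzOf (S : Set (FormalRel Q)) (K M : PRp Q) : Prop :=
  K.2 ∈ modSet S K.1 ∧ ∃ (γP : Q.V → ℕ) (P : QRep Q γP), P ∈ modSet S γP ∧ IsProjRep S P ∧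
    ∃ i ∈ HomS K.2 P, ∃ p ∈ HomS P M.2, MorInj i ∧ MorSurj p ∧
      ∀ x, LinearMap.range (Matrix.mulVecLin (i x)) = LinearMap.ker (Matrix.mulVecLin (p x))

/-- A chosen syzygy of `M` over `ℂQ/⟨S⟩`. -/
def syz (S : Set (FormalRel Q)) (M : PRp Q) : PRp Q :=
  Classical.epsilon (fun K => IsSyzOf S K M)

/-- `dim_ℂ Ext^l (M,N)` over `ℂQ/⟨S⟩`, via dimension shifting along syzygies:
`Ext⁰ = Hom`, `Ext¹` is computed by cochains, and `Ext^{l+2}(M,N) = Ext^{l+1}(ΩM,N)`. -/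
def dimExtN (S : Set (FormalRel Q)) : ℕ → PRp Q → PRp Q → ℕ
  | 0, M, N => dimHom M.2 N.2
  | 1, M, N => dimExt1 S M.2 N.2
  | (l+2), M, N => dimExtN S (l+1) (syz S M) N

/-- The simple representation `S_x` concentrated at the vertex `x`. -/
def simplePR (Q : Quiv) (x0 : Q.V) : PRp Q :=
  ⟨fun z => if z = x0 then 1 else 0, fun _ => 0⟩

/-- The Euler form pairing `⟨α, dim S_y⟩_B` of the algebra `B = ℂQ/⟨S⟩`:
`Σ_{l ≥ 0} (−1)^l Σ_x dim Ext^l_B(S_x,S_y) · α(x)`.  The weight `⟨α,−⟩_B` is the function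
`y ↦ eulerPair S α y`. -/
def eulerPair (S : Set (FormalRel Q)) (α : Q.V → ℕ) (y : Q.V) : ℤ :=
  ∑ᶠ l : ℕ, (-1 : ℤ)^l *
    ∑ x : Q.V, (α x : ℤ) * (dimExtN S l (simplePR Q x) (simplePR Q y) : ℤ)

/-- The set of relations annihilating `W`: the annihilator `Ann_{ℂQ}(W)`, so that
`B = ℂQ/Ann_{ℂQ}(W)`. -/
def annRel {β : Q.V → ℕ} (W : QRep Q β) : Set (FormalRel Q) :=
  {r | evalLin W r.2.2 = 0}

/-- The weight semigroup `L_W` of `W`: weights `σ` with `σ|_{supp β} = ⟨α,−⟩_B` for some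
dimension vector `α ∈ ℕ^{supp β}` with `P_B(α) ≠ ∅`, where `B = ℂQ/Ann_{ℂQ}(W)`. -/
def weightSgrp {β : Q.V → ℕ} (W : QRep Q β) : Set (Q.V → ℤ) :=
  {σ | ∃ α : Q.V → ℕ, (∀ x, β x = 0 → α x = 0) ∧ (PAset (annRel W) α).Nonempty ∧
    ∀ y, β y ≠ 0 → σ y = eulerPair (annRel W) α y}

end ExtHigher

section Tame

variable {Q : Quiv}

/-- Specialization of a representation over `ℂ[x]` at `λ ∈ ℂ`, i.e.
`M ⊗_{ℂ[x]} ℂ[x]/(x−λ)`. -/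
def polyEvalAt {γ : Q.V → ℕ} (M : RepR Q (Polynomial ℂ) γ) (lam : ℂ) : QRep Q γ :=
  fun a => (M a).map (fun p => Polynomial.eval lam p)

/-- The algebra `A = ℂQ/⟨S⟩` is tame: for every dimension `d` there are finitely many
`A`–`ℂ[x]`-bimodules `M₁,…,M_s`, free of finite rank over `ℂ[x]` (i.e. matrix
representations over `ℂ[x]` satisfying the relations), such that all but finitely many
isomorphism classes of `d`-dimensional indecomposable `A`-modules are of the form
`M_i ⊗_{ℂ[x]} ℂ[x]/(x−λ)`. -/
def IsTame (S : Set (FormalRel Q)) : Prop :=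
  ∀ d : ℕ, ∃ (s : ℕ) (γs : Fin s → (Q.V → ℕ)) (M : ∀ i, RepR Q (Polynomial ℂ) (γs i)),
    (∀ i, ∀ r ∈ S, evalLinP (M i) r.2.2 = 0) ∧
    ∃ (t : ℕ) (βs : Fin t → (Q.V → ℕ)) (E : ∀ k, QRep Q (βs k)),
      ∀ (α : Q.V → ℕ) (V : QRep Q α), V ∈ modSet S α → (∑ x, α x) = d → IsIndecRep V →
        (∃ k, RIso (E k) V) ∨ (∃ i lam, RIso (polyEvalAt (M i) lam) V)

end Tame

section Stability

variable {Q : Quiv}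

/-- `U` is a subrepresentation of `V` (a family of subspaces preserved by the structure
maps). -/
def SubRep {α : Q.V → ℕ} (V : QRep Q α) (U : ∀ x : Q.V, Submodule ℂ (Fin (α x) → ℂ)) : Prop :=
  ∀ a : Q.A, (U (Q.t a)).map (Matrix.mulVecLin (V a)) ≤ U (Q.h a)

/-- `V` is `θ`-stable: `V ≠ 0`, `θ · dim V = 0`, and `θ · dim V' < 0` for every proper
nonzero subrepresentation `V'` of `V`. -/
def ThetaStable {α : Q.V → ℕ} (θ : Q.V → ℤ) (V : QRep Q α) : Prop :=
  (∃ x, α x ≠ 0) ∧ (∑ x, θ x * (α x : ℤ)) = 0 ∧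
  ∀ U : ∀ x : Q.V, Submodule ℂ (Fin (α x) → ℂ), SubRep V U →
    (∃ x, U x ≠ ⊥) → (∃ x, U x ≠ ⊤) →
      (∑ x, θ x * (Module.finrank ℂ (U x) : ℤ)) < 0

/-- The morphism with components `f` from `P` is essential onto its image: any
subrepresentation of `P` mapping onto the image of `f` is all of `P`. -/
def IsEssentialTo {γ δ : Q.V → ℕ} (P : QRep Q γ)
    (f : ∀ x : Q.V, Matrix (Fin (δ x)) (Fin (γ x)) ℂ) : Prop :=
  ∀ U : ∀ x : Q.V, Submodule ℂ (Fin (γ x) → ℂ), SubRep P U →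
    (∀ x, (U x).map (Matrix.mulVecLin (f x)) = LinearMap.range (Matrix.mulVecLin (f x))) →
      ∀ x, U x = ⊤

end Stability

section Ideal

variable {Q : Quiv}

/-- The `(x,y)`-component of the two-sided ideal `⟨S⟩` of `ℂQ` generated by the
relations in `S`: the span of the translates `q·r·p` of relations `r ∈ S` by paths. -/
def idealComp (S : Set (FormalRel Q)) (x y : Q.V) : Submodule ℂ (Quiver.Path x y →₀ ℂ) :=
  Submodule.span ℂ {c | ∃ r ∈ S, ∃ (p : Quiver.Path x r.1) (q : Quiver.Path r.2.1 y),
    c = Finsupp.mapDomain (fun s => (p.comp s).comp q) r.2.2}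

/-- `W` is a faithful module over `A = ℂQ/⟨S⟩`: every element of `ℂQ` annihilating `W`
lies in the ideal `⟨S⟩`. -/
def FaithfulOver (S : Set (FormalRel Q)) {β : Q.V → ℕ} (W : QRep Q β) : Prop :=
  ∀ (x y : Q.V) (c : Quiver.Path x y →₀ ℂ), evalLin W c = 0 → c ∈ idealComp S x y

end Ideal
section Precomp

variable {Q : Quiv}

/-- Precomposition with a morphism `f : L → M` of representations, as a linear map
`Hom(M,N) → Hom(L,N)`, `φ ↦ φ ∘ f`. -/
def precompMap {γ₁ γ₀ δ : Q.V → ℕ} (L : QRep Q γ₁) (M : QRep Q γ₀) (N : QRep Q δ)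
    (f : ∀ x : Q.V, Matrix (Fin (γ₀ x)) (Fin (γ₁ x)) ℂ) (hf : f ∈ HomS L M) :
    (HomS M N) →ₗ[ℂ] (HomS L N) where
  toFun φ := ⟨fun x => φ.1 x * f x, by
    intro a
    have h1 : φ.1 (Q.h a) * M a = N a * φ.1 (Q.t a) := φ.2 a
    have h2 : f (Q.h a) * L a = M a * f (Q.t a) := hf a
    calc (φ.1 (Q.h a) * f (Q.h a)) * L a
        = φ.1 (Q.h a) * (f (Q.h a) * L a) := by rw [Matrix.mul_assoc]
      _ = φ.1 (Q.h a) * (M a * f (Q.t a)) := by rw [h2]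
      _ = (φ.1 (Q.h a) * M a) * f (Q.t a) := by rw [Matrix.mul_assoc]
      _ = (N a * φ.1 (Q.t a)) * f (Q.t a) := by rw [h1]
      _ = N a * (φ.1 (Q.t a) * f (Q.t a)) := by rw [Matrix.mul_assoc]⟩
  map_add' φ ψ := by
    apply Subtype.ext
    funext x
    simp [Matrix.add_mul]
  map_smul' c φ := by
    apply Subtype.ext
    funext x
    simp [Matrix.smul_mul]

end Precomp

section BipartiteQsig

variable (Q : Quiv) (β : Q.V → ℕ) (σ : Q.V → ℤ)

/-- The bipartite quiver `Q^σ`: its vertices are the vertices of `Q` where `σ` is positive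
together with those where `σ` is negative, and it has one arrow `a_p : v_i → w_j` for every
oriented path `p` in `Q` from `v_i` to `w_j`. -/
def Qsig : Quiv where
  V := PosV Q σ ⊕ NegV Q σ
  A := Σ (i : PosV Q σ) (j : NegV Q σ), Quiver.Path i.1 j.1
  t := fun a => Sum.inl a.1
  h := fun a => Sum.inr a.2.1
  fV := inferInstance
  dV := inferInstance

/-- The dimension vector `β` restricted to `Q^σ`. -/
def betaSig : (Qsig Q σ).V → ℕ := Sum.elim (fun i => β i.1) (fun j => β j.1)

/-- The weight `σ` restricted to `Q^σ`. -/
def sigSig : (Qsig Q σ).V → ℤ := Sum.elim (fun i => σ i.1) (fun j => σ j.1)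

/-- The morphism `φ : rep(Q,β) → rep(Q^σ,β)` given by `φ(W)(a_p) = W(p)`. -/
def phiSig (W : QRep Q β) : QRep (Qsig Q σ) (betaSig Q β σ) :=
  fun a => evalPath W a.2.2

end BipartiteQsig

section Derivations

open MvPolynomial in
/-- Prescribing a derivation on an algebraically independent family. -/
theorem exists_derivation_of_algebraicIndependent {K : Type} [Field K] [Algebra ℂ K]
    {σ : Type} {y : σ → K} (hy : AlgebraicIndependent ℂ y) (v : σ → K) :
    ∃ δ : Derivation ℂ K K, ∀ i, δ (y i) = v i := by
  classical
  obtain ⟨B, hB, hBt⟩ := exists_isTranscendenceBasis_superset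
    (s := Set.range y) hy.coe_range
  have hind : AlgebraicIndependent ℂ (Subtype.val : B → K) := hBt.1
  have hyinj : Function.Injective y := hy.injective
  let S := MvPolynomial B ℂ
  let : Algebra S K := (aeval (Subtype.val : B → K)).toAlgebra
  have hmap : ∀ p : S, algebraMap S K p = aeval (Subtype.val : B → K) p := fun p => rfl
  have : IsScalarTower ℂ S K := IsScalarTower.of_algebraMap_eq fun c =>
    (AlgHom.commutes (aeval (Subtype.val : B → K)) c).symm
  have hinj : Function.Injective (algebraMap S K) := hind
  have : FaithfulSMul S K := (faithfulSMul_iff_algebraMap_injective S K).2 hinj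
  let : Algebra (FractionRing S) K := FractionRing.liftAlgebra S K
  have : IsScalarTower S (FractionRing S) K := inferInstance
  have halg : Algebra.IsAlgebraic S K := by
    have h0 := hBt.isAlgebraic
    refine (Algebra.isAlgebraic_ringHom_iff_of_comp_eq (hind.aevalEquiv.toRingEquiv)
      (RingEquiv.refl K) ?_).1 h0
    ext p
    · simp
      exact (AlgHom.commutes (aeval (Subtype.val : B → K)) p).symm
    · simp
      exact (aeval_X (Subtype.val : B → K) p).symm
  have : Algebra.IsAlgebraic (FractionRing S) K :=
    (IsFractionRing.comap_isAlgebraic_iff (A := S) (K := FractionRing S) (C := K)).1 halg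
  have : CharZero (FractionRing S) := charZero_of_injective_algebraMap
    (FaithfulSMul.algebraMap_injective ℂ (FractionRing S))
  have : Algebra.FormallyEtale (FractionRing S) K := Algebra.FormallyEtale.of_isSeparable _ _
  have : Algebra.FormallyEtale S (FractionRing S) :=
    Algebra.FormallyEtale.of_isLocalization (nonZeroDivisors S)
  have : Algebra.FormallyEtale S K := Algebra.FormallyEtale.comp S (FractionRing S) K
  let w : B → K := fun b => if h : ∃ i, y i = b then v h.choose else 0
  let D0 : Derivation ℂ S K := mkDerivation ℂ w
  let l := LinearMap.liftBaseChange K D0.liftKaehlerDifferential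
  let e := (KaehlerDifferential.tensorKaehlerEquivOfFormallyEtale ℂ S K).symm
  refine ⟨(l ∘ₗ e.toLinearMap).compDer (KaehlerDifferential.D ℂ K), fun i => ?_⟩
  have hyi : y i = algebraMap S K (X ⟨y i, hB ⟨i, rfl⟩⟩) := by simp [hmap]
  have h1 : e (KaehlerDifferential.D ℂ K (y i)) =
      1 ⊗ₜ KaehlerDifferential.D ℂ S (X ⟨y i, hB ⟨i, rfl⟩⟩) := by
    conv_lhs => rw [hyi]
    exact KaehlerDifferential.tensorKaehlerEquivOfFormallyEtale_symm_D_algebraMap _ _ _ _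
  change l (e (KaehlerDifferential.D ℂ K (y i))) = _
  rw [h1, LinearMap.liftBaseChange_tmul, Derivation.liftKaehlerDifferential_comp_D, one_smul]
  rw [mkDerivation_X]
  have hex : ∃ j, y j = y i := ⟨i, rfl⟩
  simp only [w]
  rw [dif_pos hex]
  exact congrArg v (hyinj hex.choose_spec)

/-- A derivation vanishing on a family vanishes on everything algebraic over it. -/
theorem derivation_eq_zero_of_isIntegral {K : Type} [Field K] [Algebra ℂ K]
    (A : Subalgebra ℂ K) (δ : Derivation ℂ K K) (hA : ∀ a ∈ A, δ a = 0) {x : K}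
    (hx : IsIntegral A x) : δ x = 0 := by
  classical
  let δA : Derivation A K K := 
    { toFun := δ
      map_add' := map_add δ
      map_smul' := fun a z => by
        simp [Algebra.smul_def, hA a.1 a.2, Derivation.leibniz, Subalgebra.algebraMap_eq]
      map_one_eq_zero' := δ.map_one_eq_zero
      leibniz' := δ.leibniz }
  have hχ : ∀ z, δA z = δ z := fun _ => rfl
  have : CharZero A := charZero_of_injective_algebraMap (algebraMap ℂ A).injective
  obtain ⟨p, hp0, hpx, hmin⟩ : ∃ p : Polynomial A, p ≠ 0 ∧ Polynomial.aeval x p = 0 ∧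
      ∀ q : Polynomial A, q ≠ 0 → Polynomial.aeval x q = 0 → p.natDegree ≤ q.natDegree := by
    obtain ⟨q, hq, hqx⟩ := hx.isAlgebraic
    let P : ℕ → Prop := fun n => ∃ q : Polynomial A, q ≠ 0 ∧ Polynomial.aeval x q = 0 ∧
      q.natDegree = n
    have hP : ∃ n, P n := ⟨_, q, hq, hqx, rfl⟩
    obtain ⟨p, h1, h2, h3⟩ := Nat.find_spec hP
    exact ⟨p, h1, h2, fun q hq hqx => h3 ▸ Nat.find_min' hP ⟨q, hq, hqx, rfl⟩⟩
  have h := Derivation.map_aeval δA p x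
  rw [hpx, map_zero, smul_eq_mul] at h
  rcases mul_eq_zero.1 h.symm with h' | h'
  · exfalso
    have hdeg : p.natDegree ≠ 0 := by
      intro h0
      obtain ⟨c, rfl⟩ := Polynomial.natDegree_eq_zero.1 h0
      rw [Polynomial.aeval_C] at hpx
      apply hp0
      have : c = 0 := by
        exact (FaithfulSMul.algebraMap_injective A K) (by rw [hpx, map_zero])
      simp [this]
    by_cases hd : Polynomial.derivative p = 0
    · exact hdeg (Polynomial.derivative_eq_zero.1 hd)
    · have h1 := hmin _ hd h'
      have h2 := Polynomial.natDegree_derivative_lt hdeg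
      omega
  · exact h'

/-- The `K`-linear map sending a derivation to its values on a family. -/
def derValues {K : Type} [Field K] [Algebra ℂ K] {ι : Type} (η : ι → K) :
    Derivation ℂ K K →ₗ[K] (ι → K) where
  toFun δ := fun j => δ (η j)
  map_add' _ _ := rfl
  map_smul' _ _ := rfl

/-- The rank of the differential of a family of elements of a field over `ℂ`. -/
def derRank {K : Type} [Field K] [Algebra ℂ K] {ι : Type} (η : ι → K) : ℕ :=
  Module.finrank K (LinearMap.range (derValues η))

end Derivations

section ZariskiSpace

open MvPolynomial

/-- Affine space with its Zariski topology. -/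
def ZSpace (ι : Type) : Type := ι → ℂ

instance (ι : Type) : TopologicalSpace (ZSpace ι) := zarPi ι

/-- The value of a polynomial at a point of affine space. -/
def ZSpace.ev {ι : Type} (x : ZSpace ι) (p : MvPolynomial ι ℂ) : ℂ := eval (R := ℂ) x p

@[simp] theorem ZSpace.ev_mul {ι : Type} (x : ZSpace ι) (p q : MvPolynomial ι ℂ) :
    x.ev (p * q) = x.ev p * x.ev q := map_mul _ _ _
@[simp] theorem ZSpace.ev_one {ι : Type} (x : ZSpace ι) : x.ev 1 = 1 := map_one _

theorem ZSpace.isOpen_ne {ι : Type} (p : MvPolynomial ι ℂ) :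
    IsOpen {x : ZSpace ι | x.ev p ≠ 0} :=
  TopologicalSpace.isOpen_generateFrom_of_mem ⟨p, rfl⟩

theorem ZSpace.isBasis (ι : Type) : TopologicalSpace.IsTopologicalBasis
    {U : Set (ZSpace ι) | ∃ p : MvPolynomial ι ℂ, U = {x | x.ev p ≠ 0}} where
  exists_subset_inter := by
    rintro _ ⟨p, rfl⟩ _ ⟨q, rfl⟩ x ⟨hp, hq⟩
    refine ⟨_, ⟨p * q, rfl⟩, ?_, ?_⟩
    · simpa using ⟨hp, hq⟩
    · intro y hy
      simpa using hy
  sUnion_eq := by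
    refine Set.eq_univ_of_forall fun x => ?_
    exact ⟨_, ⟨1, rfl⟩, by simp⟩
  eq_generateFrom := rfl

theorem ZSpace.mem_closure_iff {ι : Type} {s : Set (ZSpace ι)} {x : ZSpace ι} :
    x ∈ closure s ↔ ∀ p, (∀ y ∈ s, y.ev p = 0) → x.ev p = 0 := by
  rw [(ZSpace.isBasis ι).mem_closure_iff]
  constructor
  · intro h p hp
    by_contra hx
    obtain ⟨y, hy, hys⟩ := h _ ⟨p, rfl⟩ hx
    exact hy (hp y hys)
  · rintro h _ ⟨p, rfl⟩ hx
    by_contra hne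
    apply hx
    refine h p fun y hy => ?_
    by_contra h'
    exact hne ⟨y, h', hy⟩

/-- The zero locus of all polynomial relations satisfied by `η`. -/
def relLocus {K : Type} [CommRing K] [Algebra ℂ K] {ι : Type} (η : ι → K) : Set (ZSpace ι) :=
  {x | ∀ p : MvPolynomial ι ℂ, aeval η p = 0 → x.ev p = 0}

theorem isClosed_relLocus {K : Type} [CommRing K] [Algebra ℂ K] {ι : Type} (η : ι → K) :
    IsClosed (relLocus η) := by
  apply isClosed_of_closure_subset
  intro x hx p hp
  exact ZSpace.mem_closure_iff.1 hx p fun y hy => hy p hp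

/-- Nullstellensatz: a polynomial outside a prime ideal is non-zero at some zero of the ideal. -/
theorem exists_zero_of_notMem_prime {ι : Type} [Finite ι] (P : Ideal (MvPolynomial ι ℂ))
    [P.IsPrime] {p : MvPolynomial ι ℂ} (hp : p ∉ P) :
    ∃ x : ZSpace ι, (∀ q ∈ P, x.ev q = 0) ∧ x.ev p ≠ 0 := by
  by_contra hcon
  push Not at hcon
  apply hp
  rw [← MvPolynomial.IsPrime.vanishingIdeal_zeroLocus (K := ℂ) P]
  intro x hx
  exact hcon x hx

theorem ringKrullDim_eq_of_isIntegral {s : ℕ} {C : Type} [CommRing C] [IsDomain C] [Algebra ℂ C]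
    (g : MvPolynomial (Fin s) ℂ →ₐ[ℂ] C) (hinj : Function.Injective g) (hint : g.IsIntegral) :
    ringKrullDim C = s := by
  let : Algebra (MvPolynomial (Fin s) ℂ) C := g.toAlgebra
  have hI : Algebra.IsIntegral (MvPolynomial (Fin s) ℂ) C := ⟨hint⟩
  have hF : FaithfulSMul (MvPolynomial (Fin s) ℂ) C :=
    (faithfulSMul_iff_algebraMap_injective _ _).2 hinj
  have h0 : ringKrullDim (MvPolynomial (Fin s) ℂ) = s := by
    rw [MvPolynomial.ringKrullDim_of_isNoetherianRing, ringKrullDim_eq_zero_of_field]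
    simp
  rw [← h0]
  apply le_antisymm
  · apply Order.krullDim_le_of_strictMono
      (PrimeSpectrum.comap (algebraMap (MvPolynomial (Fin s) ℂ) C))
    intro P Q hPQ
    exact Ideal.IsIntegral.comap_lt_comap (R := MvPolynomial (Fin s) ℂ)
      (I := P.asIdeal) (J := Q.asIdeal) hPQ
  · apply iSup_le
    intro L
    obtain ⟨P, hP, hPo⟩ := Ideal.exists_ideal_over_prime_of_isIntegral (S := C)
      L.head.asIdeal (⊥ : Ideal C) (by
        rw [← RingHom.ker, (RingHom.injective_iff_ker_eq_bot
          (algebraMap (MvPolynomial (Fin s) ℂ) C)).1 hinj]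
        exact bot_le)
    have : P.LiesOver L.head.asIdeal := ⟨hPo.2.symm⟩
    have := hPo.1
    obtain ⟨L', hlen, -⟩ := Ideal.exists_ltSeries_of_hasGoingUp L P
    rw [← hlen]
    exact le_iSup (fun L : LTSeries (PrimeSpectrum C) => (L.length : WithBot ℕ∞)) L'

section
variable {K : Type} [Field K] [Algebra ℂ K] {ι : Type} (η : ι → K)

/-- The ideal of polynomial relations. -/
abbrev relIdeal : Ideal (MvPolynomial ι ℂ) := RingHom.ker (aeval (R := ℂ) η)

instance : (relIdeal η).IsPrime := RingHom.ker_isPrime _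

theorem relLocus_dim_le : topologicalKrullDim (relLocus η) ≤
    ringKrullDim (MvPolynomial ι ℂ ⧸ relIdeal η) := by
  rw [← PrimeSpectrum.topologicalKrullDim_eq_ringKrullDim]
  let e : ∀ x : relLocus η, (MvPolynomial ι ℂ ⧸ relIdeal η) →+* ℂ := fun x =>
    Ideal.Quotient.lift (relIdeal η) (eval (R := ℂ) x.1) (fun p hp => x.2 p hp)
  let f : relLocus η → PrimeSpectrum (MvPolynomial ι ℂ ⧸ relIdeal η) := fun x =>
    ⟨RingHom.ker (e x), RingHom.ker_isPrime _⟩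
  have hf : Topology.IsInducing f := by
    constructor
    rw [PrimeSpectrum.isTopologicalBasis_basic_opens.eq_generateFrom, induced_generateFrom_eq]
    change TopologicalSpace.induced Subtype.val (zarPi ι) = _
    rw [zarPi, induced_generateFrom_eq]
    congr 1
    ext U
    constructor
    · rintro ⟨_, ⟨p, rfl⟩, rfl⟩
      exact ⟨_, ⟨Ideal.Quotient.mk _ p, rfl⟩, rfl⟩
    · rintro ⟨_, ⟨p, rfl⟩, rfl⟩
      obtain ⟨p, rfl⟩ := Ideal.Quotient.mk_surjective p
      exact ⟨_, ⟨p, rfl⟩, rfl⟩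
  exact hf.topologicalKrullDim_le

theorem le_relLocus_dim [Finite ι] : ringKrullDim (MvPolynomial ι ℂ ⧸ relIdeal η) ≤
    topologicalKrullDim (relLocus η) := by
  let π := Ideal.Quotient.mk (relIdeal η)
  have NS : ∀ P : PrimeSpectrum (MvPolynomial ι ℂ ⧸ relIdeal η), ∀ p, π p ∉ P.asIdeal →
      ∃ x : relLocus η, (∀ q, π q ∈ P.asIdeal → x.1.ev q = 0) ∧ x.1.ev p ≠ 0 := by
    intro P p hp
    obtain ⟨x, hx, hxp⟩ := exists_zero_of_notMem_prime (P.asIdeal.comap π) (p := p) hp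
    refine ⟨⟨x, fun q hq => hx q ?_⟩, hx, hxp⟩
    have : π q = 0 := Ideal.Quotient.eq_zero_iff_mem.2 hq
    simp [Ideal.mem_comap, this]
  let Z : PrimeSpectrum (MvPolynomial ι ℂ ⧸ relIdeal η) → Set (relLocus η) := fun P =>
    {x | ∀ q, π q ∈ P.asIdeal → x.1.ev q = 0}
  have hZc : ∀ P, IsClosed (Z P) := by
    intro P
    have : Z P = Subtype.val ⁻¹' (closure {x : ZSpace ι | ∀ q, π q ∈ P.asIdeal → x.ev q = 0}) := by
      ext x
      constructor
      · intro hx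
        exact subset_closure hx
      · intro hx q hq
        exact ZSpace.mem_closure_iff.1 hx q fun y hy => hy q hq
    rw [this]
    exact isClosed_closure.preimage continuous_subtype_val
  have hZi : ∀ P, IsIrreducible (Z P) := by
    intro P
    have hone : π 1 ∉ P.asIdeal := by
      rw [map_one]; exact P.isPrime.one_notMem
    obtain ⟨x, hx, -⟩ := NS P 1 hone
    refine ⟨⟨x, hx⟩, ?_⟩
    have hbas := (ZSpace.isBasis ι).induced (Subtype.val : relLocus η → ZSpace ι)
    have key : ∀ u v : MvPolynomial ι ℂ, (∃ y ∈ Z P, y.1.ev u ≠ 0) → (∃ y ∈ Z P, y.1.ev v ≠ 0) →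
        ∃ y ∈ Z P, y.1.ev u ≠ 0 ∧ y.1.ev v ≠ 0 := by
      rintro u v ⟨y, hy, hyu⟩ ⟨z, hz, hzv⟩
      have hu : π u ∉ P.asIdeal := fun h => hyu (hy u h)
      have hv : π v ∉ P.asIdeal := fun h => hzv (hz v h)
      have huv : π (u * v) ∉ P.asIdeal := by
        rw [map_mul]
        exact fun h => (P.isPrime.mem_or_mem h).elim hu hv
      obtain ⟨w, hw, hwuv⟩ := NS P _ huv
      rw [ZSpace.ev_mul] at hwuv
      exact ⟨w, hw, left_ne_zero_of_mul hwuv, right_ne_zero_of_mul hwuv⟩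
    intro U V hU hV ⟨y, hy, hyU⟩ ⟨z, hz, hzV⟩
    obtain ⟨_, ⟨_, ⟨u, rfl⟩, rfl⟩, hyu, hu⟩ := hbas.exists_subset_of_mem_open hyU hU
    obtain ⟨_, ⟨_, ⟨v, rfl⟩, rfl⟩, hzv, hv⟩ := hbas.exists_subset_of_mem_open hzV hV
    obtain ⟨w, hw, hwu, hwv⟩ := key u v ⟨y, hy, hyu⟩ ⟨z, hz, hzv⟩
    exact ⟨w, hw, hu hwu, hv hwv⟩
  have hZle : ∀ P Q, Z Q ⊆ Z P → P ≤ Q := by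
    intro P Q h p hp
    obtain ⟨p, rfl⟩ := Ideal.Quotient.mk_surjective p
    by_contra hpQ
    obtain ⟨x, hx, hxp⟩ := NS Q p hpQ
    exact hxp (h hx p hp)
  have hZan : ∀ P Q, P ≤ Q → Z Q ⊆ Z P := fun P Q h x hx q hq => hx q (h hq)
  let F : (PrimeSpectrum (MvPolynomial ι ℂ ⧸ relIdeal η))ᵒᵈ →
      TopologicalSpace.IrreducibleCloseds (relLocus η) :=
    fun P => ⟨Z (OrderDual.ofDual P), hZi _, hZc _⟩
  have hF : StrictMono F := by
    intro P Q hPQ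
    rw [lt_iff_le_not_ge]
    exact ⟨hZan _ _ (OrderDual.ofDual_lt_ofDual.2 hPQ).le,
      fun h => absurd (hZle _ _ h) (OrderDual.ofDual_lt_ofDual.2 hPQ).not_ge⟩
  unfold ringKrullDim topologicalKrullDim
  rw [← Order.krullDim_orderDual]
  exact Order.krullDim_le_of_strictMono F hF

/-- Families with the same derivations vanishing on them have the same rank. -/
theorem derRank_eq_of_iff {κ : Type} {η : ι → K} {ζ : κ → K}
    (h : ∀ δ : Derivation ℂ K K, (∀ j, δ (η j) = 0) ↔ ∀ k, δ (ζ k) = 0) :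
    derRank η = derRank ζ := by
  have hker : LinearMap.ker (derValues η) = LinearMap.ker (derValues ζ) := by
    ext δ
    simp only [LinearMap.mem_ker, funext_iff]
    exact h δ
  exact LinearEquiv.finrank_eq ((LinearMap.quotKerEquivRange _).symm.trans
    ((Submodule.quotEquivOfEq _ _ hker).trans (LinearMap.quotKerEquivRange _)))

/-- The dimension of the relation locus is the rank of the differential. -/
theorem relLocus_dim [Finite ι] : topologicalKrullDim (relLocus η) = derRank η := by
  rw [le_antisymm (relLocus_dim_le η) (le_relLocus_dim η)]
  obtain ⟨s, g, hinj, hint⟩ := exists_integral_inj_algHom_of_fg ℂ (MvPolynomial ι ℂ ⧸ relIdeal η)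
  rw [ringKrullDim_eq_of_isIntegral g hinj hint]
  let φ : (MvPolynomial ι ℂ ⧸ relIdeal η) →ₐ[ℂ] K := Ideal.kerLiftAlg (aeval (R := ℂ) η)
  have hφ : Function.Injective φ := Ideal.kerLiftAlg_injective _
  have hφη : ∀ p, φ (Ideal.Quotient.mk _ p) = aeval η p := fun p => rfl
  let y : Fin s → K := fun i => φ (g (X i))
  have hyae : aeval (R := ℂ) y = φ.comp g := by
    ext i; simp [y]
  have hy : AlgebraicIndependent ℂ y := by
    change Function.Injective (aeval (R := ℂ) y)
    rw [hyae]
    exact hφ.comp hinj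
  have hsurj : LinearMap.range (derValues y) = ⊤ := by
    rw [LinearMap.range_eq_top]
    intro v
    obtain ⟨δ, hδ⟩ := exists_derivation_of_algebraicIndependent hy v
    exact ⟨δ, funext hδ⟩
  have hs : derRank y = s := by
    rw [derRank, hsurj, finrank_top, Module.finrank_fin_fun]
  have h0 : ∀ {κ : Type} (ζ : κ → K) (δ : Derivation ℂ K K), (∀ k, δ (ζ k) = 0) →
      ∀ p : MvPolynomial κ ℂ, δ (aeval ζ p) = 0 := by
    intro κ ζ δ h p
    induction p using MvPolynomial.induction_on with
    | C a => simp
    | add p q hp hq => simp [hp, hq]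
    | mul_X p i hp => simp [hp, h]
  rw [← hs]
  congr 1
  symm
  apply derRank_eq_of_iff
  intro δ
  constructor
  · intro h k
    obtain ⟨p, hp⟩ := Ideal.Quotient.mk_surjective (g (X k))
    simp only [y]
    rw [← hp, hφη]
    exact h0 η δ h p
  · intro h j
    have hj : IsIntegral (aeval (R := ℂ) y).range (η j) := by
      have h1 := hint (Ideal.Quotient.mk _ (X j))
      obtain ⟨q, hq, hq0⟩ := h1
      let r : MvPolynomial (Fin s) ℂ →+* (aeval (R := ℂ) y).range :=
        (aeval (R := ℂ) y).rangeRestrict.toRingHom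
      refine ⟨q.map r, hq.map r, ?_⟩
      rw [Polynomial.eval₂_map]
      have h2 := congrArg φ hq0
      rw [map_zero, ← AlgHom.coe_toRingHom, Polynomial.hom_eval₂] at h2
      have h3 : φ.toRingHom (Ideal.Quotient.mk _ (X j)) = η j := by
        exact (hφη _).trans (aeval_X _ _)
      have h4 : (algebraMap (aeval (R := ℂ) y).range K).comp r = φ.toRingHom.comp g.toRingHom := by
        ext i
        · simp [r]
        · simp [r, y]
      rw [h4, ← h3]
      exact h2
    apply derivation_eq_zero_of_isIntegral _ δ _ hj
    rintro _ ⟨p, rfl⟩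
    exact h0 y δ h p

end

end ZariskiSpace

section ZariskiImages

open MvPolynomial

theorem ZSpace.isIrreducible_of {ι : Type} {s : Set (ZSpace ι)} (hne : s.Nonempty)
    (h : ∀ u v : MvPolynomial ι ℂ, (∃ y ∈ s, y.ev u ≠ 0) → (∃ y ∈ s, y.ev v ≠ 0) →
      ∃ y ∈ s, y.ev (u * v) ≠ 0) : IsIrreducible s := by
  refine ⟨hne, ?_⟩
  intro U V hU hV ⟨y, hy, hyU⟩ ⟨z, hz, hzV⟩
  obtain ⟨_, ⟨u, rfl⟩, hyu, hu⟩ := (ZSpace.isBasis ι).exists_subset_of_mem_open hyU hU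
  obtain ⟨_, ⟨v, rfl⟩, hzv, hv⟩ := (ZSpace.isBasis ι).exists_subset_of_mem_open hzV hV
  obtain ⟨w, hw, hwuv⟩ := h u v ⟨y, hy, hyu⟩ ⟨z, hz, hzv⟩
  rw [ZSpace.ev_mul] at hwuv
  exact ⟨w, hw, hu (left_ne_zero_of_mul hwuv), hv (right_ne_zero_of_mul hwuv)⟩

variable {ι : Type} {B : Type} [CommRing B] [Algebra ℂ B] (η : ι → B)

/-- The set of closed points parametrized by a family of regular functions. -/
def evalImage : Set (ZSpace ι) := {x | ∃ ψ : B →ₐ[ℂ] ℂ, ∀ j, x j = ψ (η j)}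

variable {η}

theorem ev_of_eq {x : ZSpace ι} {ψ : B →ₐ[ℂ] ℂ} (h : ∀ j, x j = ψ (η j))
    (p : MvPolynomial ι ℂ) : x.ev p = ψ (aeval η p) := by
  have : (x : ι → ℂ) = fun j => ψ (η j) := funext h
  unfold ZSpace.ev
  rw [this]
  induction p using MvPolynomial.induction_on with
  | C a => simp
  | add p q hp hq => rw [map_add, hp, hq, map_add, map_add]
  | mul_X p i hp => rw [map_mul, hp]; simp

theorem exists_algHom_of_prime [Algebra.FiniteType ℂ B] (Q : Ideal B) [Q.IsPrime] {b : B}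
    (hb : b ∉ Q) : ∃ ψ : B →ₐ[ℂ] ℂ, (∀ q ∈ Q, ψ q = 0) ∧ ψ b ≠ 0 := by
  obtain ⟨n, f, hf⟩ := Algebra.FiniteType.iff_quotient_mvPolynomial''.1
    (inferInstance : Algebra.FiniteType ℂ B)
  obtain ⟨p, rfl⟩ := hf b
  obtain ⟨x, hx, hxp⟩ := exists_zero_of_notMem_prime (Q.comap f) (p := p) hb
  let e : MvPolynomial (Fin n) ℂ →ₐ[ℂ] ℂ := aeval (R := ℂ) (x : Fin n → ℂ)
  have he : ∀ q, e q = x.ev q := fun q => rfl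
  have hk : RingHom.ker f ≤ RingHom.ker e := by
    intro q hq
    have h0 : f q = 0 := hq
    change e q = 0
    rw [he]
    apply hx
    simp [Ideal.mem_comap, h0]
  let ψ : B →ₐ[ℂ] ℂ := AlgHom.liftOfSurjective f hf e hk
  have hψ : ∀ q, ψ (f q) = x.ev q := fun q => by
    rw [← he]
    exact AlgHom.liftOfSurjective_apply f hf e hk q
  refine ⟨ψ, ?_, ?_⟩
  · intro q hq
    obtain ⟨q, rfl⟩ := hf q
    rw [hψ]
    exact hx q hq
  · rw [hψ]; exact hxp

theorem exists_algHom_ne_zero [IsDomain B] [Algebra.FiniteType ℂ B] {b : B} (hb : b ≠ 0) :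
    ∃ ψ : B →ₐ[ℂ] ℂ, ψ b ≠ 0 := by
  obtain ⟨ψ, -, h⟩ := exists_algHom_of_prime (⊥ : Ideal B) (b := b) (by simpa using hb)
  exact ⟨ψ, h⟩

theorem closure_evalImage [IsDomain B] [Algebra.FiniteType ℂ B] :
    closure (evalImage η) = relLocus η := by
  apply le_antisymm
  · apply closure_minimal _ (isClosed_relLocus η)
    rintro x ⟨ψ, hψ⟩ p hp
    rw [ev_of_eq hψ, hp, map_zero]
  · intro x hx
    rw [ZSpace.mem_closure_iff]
    intro p hp
    apply hx
    by_contra hne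
    obtain ⟨ψ, hψ⟩ := exists_algHom_ne_zero hne
    apply hψ
    rw [← ev_of_eq (x := fun j => ψ (η j)) (fun j => rfl)]
    exact hp _ ⟨ψ, fun j => rfl⟩

theorem isIrreducible_evalImage [IsDomain B] [Algebra.FiniteType ℂ B] :
    IsIrreducible (evalImage η) := by
  obtain ⟨ψ, -⟩ := exists_algHom_ne_zero (one_ne_zero (α := B))
  have hne : (evalImage η).Nonempty := ⟨(fun j => ψ (η j) : ι → ℂ), ψ, fun j => rfl⟩
  apply ZSpace.isIrreducible_of hne
  rintro u v ⟨y, ⟨ψ₁, h₁⟩, hu⟩ ⟨z, ⟨ψ₂, h₂⟩, hv⟩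
  rw [ev_of_eq h₁] at hu
  rw [ev_of_eq h₂] at hv
  have hu' : aeval η u ≠ 0 := fun h => hu (by rw [h, map_zero])
  have hv' : aeval η v ≠ 0 := fun h => hv (by rw [h, map_zero])
  obtain ⟨χ, hχ⟩ := exists_algHom_ne_zero (mul_ne_zero hu' hv')
  refine ⟨(fun j => χ (η j) : ι → ℂ), ⟨χ, fun j => rfl⟩, ?_⟩
  rw [ev_of_eq (x := (fun j => χ (η j) : ι → ℂ)) (ψ := χ) (η := η) (fun j => rfl), map_mul]
  exact hχ

theorem evalImage_contains_open [Finite ι] [IsDomain B] [Algebra.FiniteType ℂ B] :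
    ∃ f : MvPolynomial ι ℂ, aeval η f ≠ 0 ∧ ∀ x ∈ relLocus η, x.ev f ≠ 0 → x ∈ evalImage η := by
  let I := RingHom.ker (aeval (R := ℂ) η)
  let g : (MvPolynomial ι ℂ ⧸ I) →ₐ[ℂ] B := Ideal.kerLiftAlg (aeval (R := ℂ) η)
  have hg : Function.Injective g := Ideal.kerLiftAlg_injective _
  have hgη : ∀ p, g (Ideal.Quotient.mk _ p) = aeval η p := fun p => rfl
  have hP : I.IsPrime := RingHom.ker_isPrime _
  have hft : (g : (MvPolynomial ι ℂ ⧸ I) →+* B).FiniteType := by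
    apply RingHom.FiniteType.of_comp_finiteType (f := algebraMap ℂ (MvPolynomial ι ℂ ⧸ I))
    have : (g : (MvPolynomial ι ℂ ⧸ I) →+* B).comp (algebraMap ℂ (MvPolynomial ι ℂ ⧸ I)) =
      algebraMap ℂ B := g.comp_algebraMap
    rw [this, RingHom.finiteType_algebraMap]
    infer_instance
  have hcon := PrimeSpectrum.isConstructible_range_comap
    (RingHom.FinitePresentation.of_finiteType.1 hft)
  obtain ⟨S, hS⟩ := PrimeSpectrum.exists_constructibleSetData_iff.2 hcon
  have hbot : (⊥ : PrimeSpectrum (MvPolynomial ι ℂ ⧸ I)) ∈ S.toSet := by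
    rw [hS]
    refine ⟨⊥, ?_⟩
    ext x
    simp only [PrimeSpectrum.comap_asIdeal, Ideal.mem_comap]
    change g x ∈ (⊥ : Ideal B) ↔ x ∈ (⊥ : Ideal _)
    simp [map_eq_zero_iff g hg]
  simp only [PrimeSpectrum.ConstructibleSetData.toSet, Set.mem_iUnion] at hbot
  obtain ⟨C, hC, hC1, hC2⟩ := hbot
  obtain ⟨f, hf⟩ := Ideal.Quotient.mk_surjective C.f
  refine ⟨f, ?_, ?_⟩
  · intro h0
    apply hC2
    have : C.f = 0 := by
      apply hg
      rw [← hf, hgη, h0, map_zero]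
    simp [this]
  · intro x hx hxf
    let e : (MvPolynomial ι ℂ ⧸ I) →+* ℂ :=
      Ideal.Quotient.lift I (eval (R := ℂ) x) (fun p hp => hx p hp)
    have he : ∀ p, e (Ideal.Quotient.mk _ p) = x.ev p := fun p => rfl
    let m : PrimeSpectrum (MvPolynomial ι ℂ ⧸ I) := ⟨RingHom.ker e, RingHom.ker_isPrime _⟩
    have hm : m ∈ S.toSet := by
      simp only [PrimeSpectrum.ConstructibleSetData.toSet, Set.mem_iUnion]
      refine ⟨C, hC, ?_, ?_⟩
      · intro c hc
        have h0 : c = 0 := hC1 hc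
        rw [h0]
        exact m.asIdeal.zero_mem
      · intro h
        have h1 : C.f ∈ m.asIdeal := h rfl
        apply hxf
        rw [← he, hf]
        exact h1
    rw [hS] at hm
    obtain ⟨Q, hQ⟩ := hm
    obtain ⟨ψ, hψ, -⟩ := exists_algHom_of_prime Q.asIdeal (b := 1) Q.isPrime.one_notMem
    have hzero : ∀ p : MvPolynomial ι ℂ, x.ev p = 0 → ψ (aeval η p) = 0 := by
      intro p hp
      apply hψ
      have h1 : Ideal.Quotient.mk I p ∈ m.asIdeal := by
        change e _ = 0
        rw [he, hp]
      rw [← hQ] at h1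
      exact h1
    refine ⟨ψ, fun j => ?_⟩
    have := hzero (X j - MvPolynomial.C (x j)) (by
      simp only [ZSpace.ev, map_sub]
      exact sub_eq_zero.2 ((eval_X _).trans (eval_C (x j)).symm))
    simp only [map_sub, aeval_X, aeval_C, AlgHom.commutes] at this
    exact (sub_eq_zero.1 this).symm

end ZariskiImages

section ZariskiDimension

open MvPolynomial

theorem relLocus_map {ι B K : Type} [CommRing B] [Algebra ℂ B] [CommRing K] [Algebra ℂ K]
    (f : B →ₐ[ℂ] K) (hf : Function.Injective f) (η : ι → B) :
    relLocus (fun j => f (η j)) = relLocus η := by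
  have h : ∀ p : MvPolynomial ι ℂ, aeval (fun j => f (η j)) p = f (aeval η p) := by
    intro p
    have : aeval (R := ℂ) (fun j => f (η j)) = f.comp (aeval η) := by ext; simp
    rw [this]; rfl
  ext x
  simp only [relLocus, Set.mem_ofPred_eq, h, map_eq_zero_iff f hf]

theorem aeval_option_rename {ι K : Type} [CommRing K] [Algebra ℂ K] (η : Option ι → K)
    (p : MvPolynomial ι ℂ) : aeval η (rename some p) = aeval (fun j => η (some j)) p := by
  rw [aeval_rename]; rfl

theorem derRank_le_of_isOpen {ι K : Type} [Finite ι] [Field K] [Algebra ℂ K] {η : ι → K}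
    {f : MvPolynomial ι ℂ} (hf : aeval η f ≠ 0) {S : Set (ZSpace ι)}
    (hS : ∀ x ∈ relLocus η, x.ev f ≠ 0 → x ∈ S) :
    (derRank η : WithBot ℕ∞) ≤ topologicalKrullDim S := by
  let η' : Option ι → K := fun o => o.elim (aeval η f)⁻¹ η
  have hη' : derRank η' = derRank η := by
    apply derRank_eq_of_iff
    intro δ
    refine ⟨fun h k => h (some k), fun h j => ?_⟩
    rcases j with _ | j
    · have h0 : δ (aeval η f) = 0 := by
        have hall : ∀ p : MvPolynomial ι ℂ, δ (aeval η p) = 0 := by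
          intro p
          induction p using MvPolynomial.induction_on with
          | C a => simp
          | add p q hp hq => rw [map_add, map_add, hp, hq, add_zero]
          | mul_X p i hp => rw [map_mul, Derivation.leibniz, hp, aeval_X, h i]; simp
        exact hall f
      change δ (aeval η f)⁻¹ = 0
      rw [Derivation.leibniz_inv, h0, smul_zero]
    · exact h j
  rw [← hη', ← relLocus_dim]
  let pr : ZSpace (Option ι) → ZSpace ι := fun x j => x (some j)
  have hpr : ∀ (x : ZSpace (Option ι)) p, (pr x).ev p = x.ev (rename some p) := by
    intro x p
    exact (eval_rename some (x : Option ι → ℂ) p).symm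
  have hinv : ∀ x ∈ relLocus η', x none * (pr x).ev f = 1 := by
    intro x hx
    have := hx (X none * rename some f - 1) (by
      rw [map_sub, map_mul, aeval_option_rename, aeval_X, map_one]
      change (aeval η f)⁻¹ * aeval η f - 1 = 0
      rw [inv_mul_cancel₀ hf, sub_self])
    rw [hpr]
    have h2 : x.ev (X none * rename some f - 1) = x none * x.ev (rename some f) - 1 := by
      simp only [ZSpace.ev, map_sub, map_mul, map_one]
      congr 2
      exact eval_X _
    rw [h2] at this
    exact sub_eq_zero.1 this
  have hmem : ∀ x ∈ relLocus η', pr x ∈ S := by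
    intro x hx
    apply hS
    · intro p hp
      rw [hpr]
      apply hx
      rw [aeval_option_rename]
      exact hp
    · intro h
      have := hinv x hx
      rw [h, mul_zero] at this
      exact zero_ne_one this
  have hden : ∀ p : MvPolynomial (Option ι) ℂ, ∃ (N : ℕ) (q : MvPolynomial ι ℂ),
      ∀ x ∈ relLocus η', x.ev p * (pr x).ev f ^ N = (pr x).ev q := by
    intro p
    induction p using MvPolynomial.induction_on with
    | C a =>
      refine ⟨0, MvPolynomial.C a, fun x _ => ?_⟩
      simp only [ZSpace.ev, pow_zero, mul_one]
      exact (eval_C a).trans (eval_C a).symm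
    | add p q hp hq =>
      obtain ⟨N, p', hp⟩ := hp
      obtain ⟨M, q', hq⟩ := hq
      refine ⟨N + M, p' * f ^ M + q' * f ^ N, fun x hx => ?_⟩
      have e1 : x.ev (p + q) = x.ev p + x.ev q := map_add _ _ _
      have e2 : (pr x).ev (p' * f ^ M + q' * f ^ N) =
        (pr x).ev p' * (pr x).ev f ^ M + (pr x).ev q' * (pr x).ev f ^ N := by
          simp only [ZSpace.ev, map_add, map_mul, map_pow]
      rw [e1, e2, ← hp x hx, ← hq x hx]
      ring
    | mul_X p i hp =>
      obtain ⟨N, p', hp⟩ := hp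
      have e1 : ∀ x : ZSpace (Option ι), x.ev (X i) = x i := fun x => eval_X _
      rcases i with _ | i
      · refine ⟨N + 1, p', fun x hx => ?_⟩
        rw [ZSpace.ev_mul, e1, ← hp x hx, pow_succ]
        linear_combination (x.ev p * (pr x).ev f ^ N) * hinv x hx
      · refine ⟨N, p' * X i, fun x hx => ?_⟩
        have e2 : (pr x).ev (X i) = x (some i) := eval_X _
        rw [ZSpace.ev_mul, ZSpace.ev_mul, e1, e2, ← hp x hx]
        ring
  let φ : relLocus η' → S := fun x => ⟨pr x.1, hmem x.1 x.2⟩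
  have hφ : Topology.IsInducing φ := by
    apply Topology.IsInducing.subtypeVal.of_comp_iff.1
    constructor
    refine induced_generateFrom_eq.trans (Eq.trans ?_ induced_generateFrom_eq.symm)
    congr 1
    ext U
    constructor
    · rintro ⟨_, ⟨p, rfl⟩, rfl⟩
      obtain ⟨N, q, hq⟩ := hden p
      refine ⟨_, ⟨q, rfl⟩, ?_⟩
      ext x
      have h1 : (pr x.1).ev f ≠ 0 := fun h => by
        have := hinv x.1 x.2
        rw [h, mul_zero] at this
        exact zero_ne_one this
      change (pr x.1).ev q ≠ 0 ↔ x.1.ev p ≠ 0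
      rw [← hq x.1 x.2]
      simp [h1]
    · rintro ⟨_, ⟨q, rfl⟩, rfl⟩
      refine ⟨_, ⟨rename some q, rfl⟩, ?_⟩
      ext x
      change x.1.ev (rename some q) ≠ 0 ↔ (pr x.1).ev q ≠ 0
      rw [hpr]
  exact hφ.topologicalKrullDim_le

theorem topologicalKrullDim_add_one_le {T : Type} [TopologicalSpace T] {Y X : Set T}
    (hY : IsIrreducible Y) (hY' : IsClosed Y) (hX : IsIrreducible X)
    (hlt : Y ⊂ X) : topologicalKrullDim Y + 1 ≤ topologicalKrullDim X := by
  have : IrreducibleSpace Y := Subtype.irreducibleSpace hY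
  have : IrreducibleSpace X := Subtype.irreducibleSpace hX
  let j : Y → X := Set.inclusion hlt.le
  have hj : Topology.IsInducing j := (Topology.IsEmbedding.inclusion hlt.le).isInducing
  let topY : TopologicalSpace.IrreducibleCloseds Y :=
    ⟨Set.univ, IrreducibleSpace.isIrreducible_univ Y, isClosed_univ⟩
  let topX : TopologicalSpace.IrreducibleCloseds X :=
    ⟨Set.univ, IrreducibleSpace.isIrreducible_univ X, isClosed_univ⟩
  have : Nonempty (TopologicalSpace.IrreducibleCloseds Y) := ⟨topY⟩
  let m := TopologicalSpace.IrreducibleCloseds.map j hj.continuous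
  have hm : StrictMono m := TopologicalSpace.IrreducibleCloseds.map_strictMono_of_isInducing hj
  have hlt' : ∀ Z, m Z < topX := by
    intro Z
    refine lt_of_le_of_ne (fun x _ => trivial) fun he => hlt.2 fun x hx => ?_
    have h1 : (⟨x, hx⟩ : X) ∈ (m Z : Set X) := by rw [he]; exact trivial
    rw [TopologicalSpace.IrreducibleCloseds.coe_map] at h1
    have hcl : IsClosed (Subtype.val ⁻¹' Y : Set X) := hY'.preimage continuous_subtype_val
    refine closure_minimal ?_ hcl h1
    rintro _ ⟨y, -, rfl⟩
    exact y.2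
  let F : WithTop (TopologicalSpace.IrreducibleCloseds Y) →
      TopologicalSpace.IrreducibleCloseds X := fun o => WithTop.recTopCoe topX m o
  have hF : StrictMono F := by
    intro a b hab
    induction b using WithTop.recTopCoe with
    | top =>
      induction a using WithTop.recTopCoe with
      | top => exact absurd hab (lt_irrefl _)
      | coe a => exact hlt' a
    | coe b =>
      induction a using WithTop.recTopCoe with
      | top => exact absurd hab not_top_lt
      | coe a => exact hm (WithTop.coe_lt_coe.1 hab)
  rw [topologicalKrullDim, ← Order.krullDim_WithTop]
  exact Order.krullDim_le_of_strictMono F hF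

end ZariskiDimension

section Minors

theorem Matrix.exists_linearIndependent_rows {K m n : Type} [Field K] [Finite m] [Fintype n]
    (A : Matrix m n K) : ∃ f : Fin A.rank → m, LinearIndependent K (A.submatrix f id).row := by
  rw [A.rank_eq_finrank_span_row]
  obtain ⟨v, hv, -, hli⟩ := Submodule.exists_fun_fin_finrank_span_eq K (Set.range A.row)
  choose f hf using hv
  refine ⟨f, ?_⟩
  have : (A.submatrix f id).row = v := funext hf
  rw [this]
  exact hli

theorem Matrix.exists_minor {K m n : Type} [Field K] [Fintype m] [Fintype n]
    (A : Matrix m n K) {r : ℕ} (hr : r = A.rank) :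
    ∃ (f : Fin r → m) (g : Fin r → n), (A.submatrix f g).det ≠ 0 := by
  subst hr
  obtain ⟨f, hf⟩ := A.exists_linearIndependent_rows
  have hrk : (A.submatrix f id)ᵀ.rank = A.rank := by
    rw [rank_transpose, rank_eq_finrank_span_row, finrank_span_eq_card hf, Fintype.card_fin]
  obtain ⟨g, hg⟩ := (A.submatrix f id)ᵀ.exists_linearIndependent_rows
  let e : Fin A.rank → Fin (A.submatrix f id)ᵀ.rank := Fin.cast hrk.symm
  have he : Function.Injective e := Fin.cast_injective _
  refine ⟨f, g ∘ e, ?_⟩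
  have h2 : LinearIndependent K ((A.submatrix f (g ∘ e))ᵀ).row := hg.comp e he
  have := (linearIndependent_rows_iff_isUnit.1 h2)
  rw [isUnit_transpose, isUnit_iff_isUnit_det] at this
  exact this.ne_zero

theorem Matrix.le_rank_of_minor {K m n : Type} [Field K] [Fintype n]
    (A : Matrix m n K) {r : ℕ} (f : Fin r → m) (g : Fin r → n)
    (h : (A.submatrix f g).det ≠ 0) : r ≤ A.rank := by
  have := rank_submatrix_le A f g
  rwa [rank_of_det_ne_zero h, Fintype.card_fin] at this

end Minors

section Coboundary

variable {Q : Quiv}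

/-- Entrywise image of a matrix representation. -/
def mapRep {R S : Type} {β : Q.V → ℕ} (φ : R → S) (N : RepR Q R β) : RepR Q S β :=
  fun a => (N a).map φ

/-- Families of square matrices at the vertices. -/
abbrev VMat (Q : Quiv) (R : Type) (β : Q.V → ℕ) := ∀ x : Q.V, Matrix (Fin (β x)) (Fin (β x)) R

/-- The index type of the coordinates of a family of square matrices. -/
abbrev VCoord {Q : Quiv} (β : Q.V → ℕ) := Σ x : Q.V, Fin (β x) × Fin (β x)

/-- The tangent map of the action at a representation, in coordinates. -/
def dEnd {R : Type} [CommRing R] {β : Q.V → ℕ} (N : RepR Q R β) :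
    (VCoord β → R) →ₗ[R] (RepCoord β → R) where
  toFun ξ c := ((Matrix.of fun i j => ξ ⟨Q.h c.1, i, j⟩) * N c.1
    - N c.1 * (Matrix.of fun i j => ξ ⟨Q.t c.1, i, j⟩)) c.2.1 c.2.2
  map_add' ξ ζ := by
    funext c
    simp only [Matrix.sub_apply, Matrix.mul_apply, Matrix.of_apply, Pi.add_apply, add_mul,
      mul_add, Finset.sum_add_distrib]
    ring
  map_smul' r ξ := by
    funext c
    simp only [Matrix.sub_apply, Matrix.mul_apply, Matrix.of_apply, Pi.smul_apply, smul_eq_mul,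
      RingHom.id_apply, mul_sub, Finset.mul_sum]
    congr 1 <;> exact Finset.sum_congr rfl fun _ _ => by ring

/-- The rank of the tangent map of the action. -/
def dRank {K : Type} [Field K] {β : Q.V → ℕ} (N : RepR Q K β) : ℕ :=
  Module.finrank K (LinearMap.range (dEnd N))

/-- The matrix of the tangent map of the action. -/
def dMat {R : Type} [CommRing R] {β : Q.V → ℕ} (N : RepR Q R β) :
    Matrix (RepCoord β) (VCoord β) R :=
  LinearMap.toMatrix' (dEnd N)

theorem dEnd_map {R S : Type} [CommRing R] [CommRing S] (φ : R →+* S) {β : Q.V → ℕ}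
    (N : RepR Q R β) (ξ : VCoord β → R) (c : RepCoord β) :
    dEnd (mapRep φ N) (fun v => φ (ξ v)) c = φ (dEnd N ξ c) := by
  simp [dEnd, mapRep, Matrix.mul_apply]

theorem dMat_map {R S : Type} [CommRing R] [CommRing S] (φ : R →+* S) {β : Q.V → ℕ}
    (N : RepR Q R β) : dMat (mapRep φ N) = (dMat N).map φ := by
  ext c v
  simp only [dMat, LinearMap.toMatrix'_apply, Matrix.map_apply]
  rw [← dEnd_map]
  refine congrArg (fun ξ => dEnd (mapRep φ N) ξ c) (funext fun w => ?_)
  simp only [Pi.single_apply]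
  split_ifs <;> simp

instance [Fintype Q.A] (β : Q.V → ℕ) : Fintype (RepCoord β) :=
  inferInstanceAs (Fintype (Σ a : Q.A, Fin (β (Q.h a)) × Fin (β (Q.t a))))

theorem dRank_eq {K : Type} [Field K] {β : Q.V → ℕ} (N : RepR Q K β) :
    dRank N = (dMat N).rank := by
  rw [dRank, dMat, Matrix.rank, ← Matrix.toLin'_apply', Matrix.toLin'_toMatrix']

/-- The generic matrix representation. -/
def univRep (β : Q.V → ℕ) : RepR Q (MvPolynomial (RepCoord (Q := Q) β) ℂ) β :=
  fun a => Matrix.of fun i j => MvPolynomial.X ⟨a, i, j⟩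

theorem mapRep_univRep {β : Q.V → ℕ} (W : QRep Q β) :
    mapRep (MvPolynomial.eval (repCoords W)) (univRep β) = W := by
  funext a
  ext i j
  simp only [mapRep, univRep, Matrix.map_apply, Matrix.of_apply]
  exact MvPolynomial.eval_X _

theorem exists_poly_le_dRank [Fintype Q.A] {β : Q.V → ℕ} (W : QRep Q β) :
    ∃ p : MvPolynomial (RepCoord (Q := Q) β) ℂ, MvPolynomial.eval (repCoords W) p ≠ 0 ∧
      ∀ W' : QRep Q β, MvPolynomial.eval (repCoords W') p ≠ 0 → dRank W ≤ dRank W' := by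
  obtain ⟨f, g, h⟩ := (dMat W).exists_minor (dRank_eq W)
  have key : ∀ W' : QRep Q β, MvPolynomial.eval (repCoords W')
      ((dMat (univRep β)).submatrix f g).det = ((dMat W').submatrix f g).det := by
    intro W'
    rw [RingHom.map_det]
    conv_rhs => rw [← mapRep_univRep W', dMat_map]
    rfl
  refine ⟨_, (key W).trans_ne h, fun W' hW' => ?_⟩
  rw [key] at hW'
  rw [dRank_eq W']
  exact Matrix.le_rank_of_minor _ f g hW'

/-- The rank of a polynomial family over a field is bounded by the ranks of its members. -/
theorem dRank_map_le [Fintype Q.A] {τ K : Type} [Field K] {β : Q.V → ℕ}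
    (N : RepR Q (MvPolynomial τ ℂ) β) (φ : MvPolynomial τ ℂ →+* K) {ρ : ℕ}
    (h : ∀ c : τ → ℂ, dRank (mapRep (MvPolynomial.eval c) N) ≤ ρ) : dRank (mapRep φ N) ≤ ρ := by
  obtain ⟨f, g, hd⟩ := (dMat (mapRep φ N)).exists_minor (dRank_eq _)
  have h0 : ((dMat N).submatrix f g).det ≠ 0 := by
    intro h0
    apply hd
    rw [dMat_map]
    have := RingHom.map_det φ ((dMat N).submatrix f g)
    rw [h0, map_zero] at this
    exact this.symm
  obtain ⟨c, hc⟩ := MvPolynomial.funext_iff.not.1 h0 |> not_forall.1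
  refine le_trans ?_ (h c)
  rw [dRank_eq (mapRep (MvPolynomial.eval c) N)]
  apply Matrix.le_rank_of_minor _ f g
  rw [dMat_map]
  rw [map_zero, RingHom.map_det] at hc
  exact hc

theorem dRank_le_map [Fintype Q.A] {K : Type} [Field K] {β : Q.V → ℕ} (V : QRep Q β) (φ : ℂ →+* K) :
    dRank V ≤ dRank (mapRep φ V) := by
  obtain ⟨f, g, hd⟩ := (dMat V).exists_minor (dRank_eq _)
  rw [dRank_eq (mapRep φ V)]
  apply Matrix.le_rank_of_minor _ f g
  rw [dMat_map]
  have := RingHom.map_det φ ((dMat V).submatrix f g)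
  intro h0
  apply hd
  apply φ.injective
  rw [this, map_zero]
  exact h0

end Coboundary

section RepZariski

variable {Q : Quiv} {β : Q.V → ℕ}

instance : TopologicalSpace (QRep Q β) := zarTop β

/-- The coordinate homeomorphism of the representation space with affine space. -/
def repHomeo (β : Q.V → ℕ) : QRep Q β ≃ₜ ZSpace (RepCoord (Q := Q) β) :=
  Equiv.toHomeomorphOfIsInducing
    { toFun := repCoords
      invFun := fun x a => Matrix.of fun i j => x ⟨a, i, j⟩
      left_inv := fun _ => rfl
      right_inv := fun _ => rfl } ⟨rfl⟩

/-- The value of a polynomial at a representation. -/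
def repEval (W : QRep Q β) (p : MvPolynomial (RepCoord (Q := Q) β) ℂ) : ℂ :=
  MvPolynomial.eval (repCoords W) p

theorem ev_repHomeo (W : QRep Q β) (p : MvPolynomial (RepCoord (Q := Q) β) ℂ) :
    (repHomeo β W).ev p = repEval W p := rfl

theorem mem_zclosure_iff {s : Set (QRep Q β)} {W : QRep Q β} :
    W ∈ zclosure s ↔ ∀ p, (∀ V ∈ s, repEval V p = 0) → repEval W p = 0 := by
  have h : W ∈ zclosure s ↔ repHomeo β W ∈ closure (repHomeo β '' s) := by
    rw [← (repHomeo β).image_closure, (repHomeo β).injective.mem_set_image]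
    rfl
  rw [h, ZSpace.mem_closure_iff]
  simp only [Set.forall_mem_image, ev_repHomeo]

theorem subset_zclosure (s : Set (QRep Q β)) : s ⊆ zclosure s := subset_closure

theorem zIsClosed_zclosure (s : Set (QRep Q β)) : zIsClosed (zclosure s) := isClosed_closure

theorem zclosure_minimal {s t : Set (QRep Q β)} (h : s ⊆ t) (ht : zIsClosed t) :
    zclosure s ⊆ t := closure_minimal h ht

theorem zclosure_mono {s t : Set (QRep Q β)} (h : s ⊆ t) : zclosure s ⊆ zclosure t :=
  closure_mono h

theorem zIsOpen.exists_poly {U : Set (QRep Q β)} (hU : zIsOpen U) {W : QRep Q β} (hW : W ∈ U) :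
    ∃ p, repEval W p ≠ 0 ∧ ∀ V, repEval V p ≠ 0 → V ∈ U := by
  have hU' : IsOpen ((repHomeo β).symm ⁻¹' U) := hU.preimage (repHomeo β).symm.continuous
  obtain ⟨_, ⟨p, rfl⟩, h1, h2⟩ := (ZSpace.isBasis _).exists_subset_of_mem_open
    (a := repHomeo β W) (by simpa using hW) hU'
  refine ⟨p, h1, fun V hV => ?_⟩
  have := h2 (show repHomeo β V ∈ _ from hV)
  simpa using this

theorem zIsOpen_ne (p : MvPolynomial (RepCoord (Q := Q) β) ℂ) :
    zIsOpen {W : QRep Q β | repEval W p ≠ 0} :=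
  (ZSpace.isOpen_ne p).preimage (repHomeo β).continuous

theorem zIsClosed_zero (s : Set (MvPolynomial (RepCoord (Q := Q) β) ℂ)) :
    zIsClosed {W : QRep Q β | ∀ p ∈ s, repEval W p = 0} := by
  have : {W : QRep Q β | ∀ p ∈ s, repEval W p = 0} = ⋂ p ∈ s, {W | repEval W p = 0} := by
    ext; simp
  rw [zIsClosed, this]
  refine isClosed_biInter fun p _ => ?_
  have h := (zIsOpen_ne p).isClosed_compl
  convert h using 1
  ext W
  simp

theorem zdim_eq (s : Set (QRep Q β)) : zdim s = topologicalKrullDim (repHomeo β '' s) :=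
  ((repHomeo β).image s).isHomeomorph.topologicalKrullDim_eq

theorem zdim_mono {s t : Set (QRep Q β)} (h : s ⊆ t) : zdim s ≤ zdim t :=
  (Topology.IsEmbedding.inclusion h).isInducing.topologicalKrullDim_le

theorem zdim_add_one_le {Y X : Set (QRep Q β)} (hY : zIrred Y) (hY' : zIsClosed Y)
    (hX : zIrred X) (hlt : Y ⊂ X) : zdim Y + 1 ≤ zdim X :=
  topologicalKrullDim_add_one_le hY hY' hX hlt

section Families

variable {B : Type} [CommRing B] [Algebra ℂ B]

/-- The closed points of a family of representations. -/
def repImage (η : RepR Q B β) : Set (QRep Q β) := {W | ∃ ψ : B →ₐ[ℂ] ℂ, mapRep ψ η = W}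

/-- The entries of a matrix representation. -/
def repEntries {R : Type} (η : RepR Q R β) : RepCoord (Q := Q) β → R :=
  fun c => η c.1 c.2.1 c.2.2

theorem image_repImage (η : RepR Q B β) :
    repHomeo β '' repImage η = evalImage (repEntries η) := by
  ext x
  constructor
  · rintro ⟨_, ⟨ψ, rfl⟩, rfl⟩
    exact ⟨ψ, fun j => rfl⟩
  · rintro ⟨ψ, hψ⟩
    exact ⟨_, ⟨ψ, rfl⟩, funext fun j => (hψ j).symm⟩

theorem image_zclosure (s : Set (QRep Q β)) :
    repHomeo β '' zclosure s = closure (repHomeo β '' s) := (repHomeo β).image_closure s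

variable [IsDomain B] [Algebra.FiniteType ℂ B]

theorem zIrred_zclosure_repImage (η : RepR Q B β) : zIrred (zclosure (repImage η)) := by
  have h : IsIrreducible (repHomeo β '' repImage η) := by
    rw [image_repImage]; exact isIrreducible_evalImage
  have h2 := h.image (repHomeo β).symm (repHomeo β).symm.continuous.continuousOn
  rw [← Set.image_comp, (repHomeo β).symm_comp_self, Set.image_id] at h2
  exact h2.closure

theorem repImage_contains_open [Fintype Q.A] (η : RepR Q B β) :
    ∃ f, (∃ W ∈ repImage η, repEval W f ≠ 0) ∧
      ∀ W ∈ zclosure (repImage η), repEval W f ≠ 0 → W ∈ repImage η := by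
  obtain ⟨f, hf, h⟩ := evalImage_contains_open (η := repEntries η)
  obtain ⟨ψ, hψ⟩ := exists_algHom_ne_zero hf
  refine ⟨f, ⟨_, ⟨ψ, rfl⟩, ?_⟩, fun W hW hWf => ?_⟩
  · rw [← ev_of_eq (x := repHomeo β (mapRep ψ η)) (η := repEntries η) (fun _ => rfl)] at hψ
    exact hψ
  · rw [← (repHomeo β).injective.mem_set_image, image_repImage]
    apply h _ _ hWf
    rw [← closure_evalImage, ← image_repImage, ← image_zclosure]
    exact Set.mem_image_of_mem _ hW

theorem zdim_zclosure_repImage [Fintype Q.A] (η : RepR Q B β) {K : Type} [Field K] [Algebra ℂ K]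
    (φ : B →ₐ[ℂ] K) (hφ : Function.Injective φ) :
    zdim (zclosure (repImage η)) = derRank (repEntries (mapRep φ η)) := by
  rw [zdim_eq, image_zclosure, image_repImage, closure_evalImage, ← relLocus_map φ hφ,
    relLocus_dim]
  rfl

theorem derRank_le_zdim_repImage [Fintype Q.A] (η : RepR Q B β) {K : Type} [Field K] [Algebra ℂ K]
    (φ : B →ₐ[ℂ] K) (hφ : Function.Injective φ) :
    (derRank (repEntries (mapRep φ η)) : WithBot ℕ∞) ≤ zdim (repImage η) := by
  obtain ⟨f, hf, h⟩ := evalImage_contains_open (η := repEntries η)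
  have hη : repEntries (mapRep φ η) = fun j => φ (repEntries η j) := rfl
  rw [zdim_eq, image_repImage, hη]
  apply derRank_le_of_isOpen (f := f)
  · have : MvPolynomial.aeval (R := ℂ) (fun j => φ (repEntries η j)) =
      φ.comp (MvPolynomial.aeval (repEntries η)) := by ext; simp
    rw [this]
    exact (map_ne_zero_iff φ hφ).2 hf
  · rw [relLocus_map φ hφ]
    exact h

end Families

end RepZariski

section GenericFamily

open MvPolynomial

variable {Q : Quiv} {α : Q.V → ℕ}

/-- The base change action over an arbitrary commutative ring. -/
def gActR {R : Type} [CommRing R] (g : ∀ x : Q.V, Matrix.GeneralLinearGroup (Fin (α x)) R)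
    (W : RepR Q R α) : RepR Q R α :=
  fun a => (g (Q.h a)).val * W a * ((g (Q.t a))⁻¹).val

theorem mapRep_gActR {R S : Type} [CommRing R] [CommRing S] (φ : R →+* S)
    (g : ∀ x : Q.V, Matrix.GeneralLinearGroup (Fin (α x)) R) (W : RepR Q R α) :
    mapRep φ (gActR g W) = gActR (fun x => Matrix.GeneralLinearGroup.map φ (g x)) (mapRep φ W) := by
  funext a
  simp only [mapRep, gActR, Matrix.map_mul]
  rfl

/-- The representations isomorphic to a member of a polynomial family. -/
def famSet {τ : Type} (N : RepR Q (MvPolynomial τ ℂ) α) : Set (QRep Q α) :=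
  {W | ∃ c : τ → ℂ, W ∈ orbitOf (mapRep (eval c) N)}

variable (α) in
/-- The coordinate ring of families of matrices times an affine space. -/
abbrev MatRing (τ : Type) : Type := MvPolynomial (VCoord α ⊕ τ) ℂ

variable (α) in
/-- The generic family of square matrices. -/
def univMat (τ : Type) : VMat Q (MatRing α τ) α :=
  fun x => Matrix.of fun i j => X (Sum.inl ⟨x, i, j⟩)

variable (α) in
/-- The product of the generic determinants. -/
def univDet (τ : Type) : MatRing α τ := ∏ x, (univMat α τ x).det

variable {τ : Type}

theorem eval_univMat (g : ∀ x : Q.V, Matrix (Fin (α x)) (Fin (α x)) ℂ) (c : τ → ℂ) (x : Q.V) :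
    (univMat α τ x).map (eval (Sum.elim (fun v => g v.1 v.2.1 v.2.2) c)) = g x := by
  ext i j
  simp [univMat]

theorem eval_univDet (g : ∀ x : Q.V, Matrix (Fin (α x)) (Fin (α x)) ℂ) (c : τ → ℂ) :
    eval (Sum.elim (fun v => g v.1 v.2.1 v.2.2) c) (univDet α τ) = ∏ x, (g x).det := by
  rw [univDet, map_prod]
  refine Finset.prod_congr rfl fun x _ => ?_
  rw [RingHom.map_det]
  exact congrArg Matrix.det (eval_univMat g c x)

theorem univDet_ne_zero : univDet α τ ≠ 0 := by
  intro h
  have := eval_univDet (α := α) (τ := τ) (fun x => 1) (fun _ => 0)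
  rw [h, map_zero] at this
  simp at this

section GLRing

variable {B : Type} [CommRing B] [Algebra (MatRing α τ) B] [IsLocalization.Away (univDet α τ) B]

theorem isDomain_GLRing (α : Q.V → ℕ) (τ B : Type) [CommRing B] [Algebra (MatRing α τ) B]
    [IsLocalization.Away (univDet α τ) B] : IsDomain B :=
  IsLocalization.isDomain_of_le_nonZeroDivisors B
    (powers_le_nonZeroDivisors_of_noZeroDivisors (univDet_ne_zero (α := α) (τ := τ)))

theorem algebraMap_GLRing_injective (α : Q.V → ℕ) (τ B : Type) [CommRing B]
    [Algebra (MatRing α τ) B] [IsLocalization.Away (univDet α τ) B] :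
    Function.Injective (algebraMap (MatRing α τ) B) :=
  IsLocalization.injective (M := Submonoid.powers (univDet α τ)) B
    (powers_le_nonZeroDivisors_of_noZeroDivisors (univDet_ne_zero (α := α) (τ := τ)))

variable (α τ B) in
theorem isUnit_det_univMat (x : Q.V) :
    IsUnit ((univMat α τ x).map (algebraMap (MatRing α τ) B)).det := by
  have h1 : IsUnit (algebraMap (MatRing α τ) B (univDet α τ)) :=
    IsLocalization.Away.algebraMap_isUnit _
  have h2 : algebraMap (MatRing α τ) B (univMat α τ x).det ∣
      algebraMap (MatRing α τ) B (univDet α τ) :=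
    map_dvd _ (Finset.dvd_prod_of_mem _ (Finset.mem_univ x))
  have h3 := isUnit_of_dvd_unit h2 h1
  rwa [RingHom.map_det] at h3

variable (α τ B) in
/-- The generic element of the base change group. -/
def univGL (x : Q.V) : Matrix.GeneralLinearGroup (Fin (α x)) B :=
  Matrix.GeneralLinearGroup.mk'' _ (isUnit_det_univMat α τ B x)

variable [Algebra ℂ B] [IsScalarTower ℂ (MatRing α τ) B]

variable (α τ B) in
/-- The inclusion of the parameter ring. -/
def paramHom : MvPolynomial τ ℂ →ₐ[ℂ] B :=
  (IsScalarTower.toAlgHom ℂ (MatRing α τ) B).comp (rename Sum.inr)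

variable (B) in
/-- The generic member of the family of orbits of a polynomial family. -/
def univFam (N : RepR Q (MvPolynomial τ ℂ) α) : RepR Q B α :=
  gActR (univGL α τ B) (mapRep (paramHom α τ B) N)

variable (B) in
theorem famSet_eq (N : RepR Q (MvPolynomial τ ℂ) α) : famSet N = repImage (univFam B N) := by
  ext W
  constructor
  · rintro ⟨c, g, rfl⟩
    let ev : MatRing α τ →ₐ[ℂ] ℂ := aeval (R := ℂ) (Sum.elim (fun v => (g v.1).val v.2.1 v.2.2) c)
    have hev : ∀ p, ev p = eval (Sum.elim (fun v => (g v.1).val v.2.1 v.2.2) c) p := fun p => rfl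
    have hu : IsUnit (ev (univDet α τ)) := by
      rw [hev, eval_univDet (fun x => (g x).val), isUnit_iff_ne_zero, Finset.prod_ne_zero_iff]
      intro x _
      exact ((Matrix.isUnit_iff_isUnit_det _).1 (g x).isUnit).ne_zero
    let ψ : B →ₐ[ℂ] ℂ := IsLocalization.liftAlgHom (M := Submonoid.powers (univDet α τ)) (f := ev)
      (by rintro ⟨_, n, rfl⟩; simpa using hu.pow n)
    have hψ : ∀ p, ψ (algebraMap _ _ p) = ev p := fun p => IsLocalization.lift_eq _ p
    refine ⟨ψ, ?_⟩
    change mapRep (ψ : B →+* ℂ) _ = _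
    rw [univFam, mapRep_gActR]
    have h1 : (fun x => Matrix.GeneralLinearGroup.map (ψ : B →+* ℂ) (univGL α τ B x)) = g := by
      funext x
      apply Units.ext
      ext i j
      change ψ (algebraMap _ _ (univMat α τ x i j)) = _
      rw [hψ]
      exact congrFun (congrFun (eval_univMat (fun x => (g x).val) c x) i) j
    have h2 : mapRep (ψ : B →+* ℂ) (mapRep (paramHom α τ B) N) = mapRep (eval c) N := by
      funext a
      ext i j
      change ψ (algebraMap _ _ (rename Sum.inr (N a i j))) = eval c (N a i j)
      rw [hψ, hev, eval_rename]
      rfl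
    rw [h1, h2]
    rfl
  · rintro ⟨ψ, rfl⟩
    refine ⟨fun i => ψ (paramHom α τ B (X i)), fun x =>
      Matrix.GeneralLinearGroup.map (ψ : B →+* ℂ) (univGL α τ B x), ?_⟩
    have h := mapRep_gActR (ψ : B →+* ℂ) (univGL α τ B) (mapRep (paramHom α τ B) N)
    refine Eq.trans ?_ h.symm
    have h2 : mapRep (ψ : B →+* ℂ) (mapRep (paramHom α τ B) N) =
        mapRep (eval fun i => ψ (paramHom α τ B (X i))) N := by
      funext a
      ext i j
      change (ψ.comp (paramHom α τ B)) (N a i j) = _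
      rw [aeval_unique (ψ.comp (paramHom α τ B))]
      rfl
    rw [h2]
    rfl

end GLRing

theorem finiteType_GLRing (α : Q.V → ℕ) (τ : Type) [Finite τ] :
    Algebra.FiniteType ℂ (Localization.Away (univDet α τ)) := by
  have : Finite (VCoord (Q := Q) α) := by unfold VCoord; infer_instance
  exact .trans (S := MatRing α τ) inferInstance
    (IsLocalization.finiteType_of_monoid_fg (Submonoid.powers (univDet α τ)) _)

theorem zIrred_zclosure_famSet [Finite τ] [Fintype Q.A] (N : RepR Q (MvPolynomial τ ℂ) α) :
    zIrred (zclosure (famSet N)) := by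
  let B := Localization.Away (univDet α τ)
  have : IsDomain B := isDomain_GLRing α τ B
  have := finiteType_GLRing α τ
  rw [famSet_eq B]
  exact zIrred_zclosure_repImage _

theorem famSet_contains_open [Fintype Q.A] [Finite τ] (N : RepR Q (MvPolynomial τ ℂ) α) :
    ∃ f, (∃ W ∈ famSet N, repEval W f ≠ 0) ∧
      ∀ W ∈ zclosure (famSet N), repEval W f ≠ 0 → W ∈ famSet N := by
  let B := Localization.Away (univDet α τ)
  have : IsDomain B := isDomain_GLRing α τ B
  have := finiteType_GLRing α τ
  rw [famSet_eq B]
  exact repImage_contains_open _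

end GenericFamily

section OrbitDimension

open MvPolynomial

variable {Q : Quiv} {α : Q.V → ℕ}

theorem Derivation.map_matrix_mul {K : Type} [Field K] [Algebra ℂ K] (δ : Derivation ℂ K K)
    {m n p : ℕ} (A : Matrix (Fin m) (Fin n) K) (B : Matrix (Fin n) (Fin p) K) :
    (A * B).map δ = A * B.map δ + A.map δ * B := by
  ext i j
  simp only [Matrix.map_apply, Matrix.mul_apply, map_sum, Derivation.leibniz, smul_eq_mul,
    Matrix.add_apply, ← Finset.sum_add_distrib]
  exact Finset.sum_congr rfl fun _ _ => by ring

theorem Derivation.map_matrix_inv {K : Type} [Field K] [Algebra ℂ K] (δ : Derivation ℂ K K)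
    {n : ℕ} (G : Matrix.GeneralLinearGroup (Fin n) K) :
    ((G⁻¹).val).map δ = - ((G⁻¹).val * G.val.map δ * (G⁻¹).val) := by
  have h1 : (1 : Matrix (Fin n) (Fin n) K).map δ = 0 := by
    ext i j
    by_cases h : i = j <;> simp [h]
  have h2 : (G.val * (G⁻¹).val).map δ = 0 := by
    rw [← Units.val_mul, mul_inv_cancel]; exact h1
  rw [δ.map_matrix_mul] at h2
  have h3 : (G⁻¹).val * (G.val * ((G⁻¹).val).map δ + G.val.map δ * (G⁻¹).val) = 0 := by
    rw [h2, mul_zero]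
  rw [mul_add, ← mul_assoc, ← Units.val_mul, inv_mul_cancel, Units.val_one, one_mul] at h3
  rw [eq_neg_of_add_eq_zero_left h3, mul_assoc]

theorem Derivation.map_mvPolynomial_aeval {K : Type} [Field K] [Algebra ℂ K] (δ : Derivation ℂ K K)
    {τ : Type} [Fintype τ] (t : τ → K) (p : MvPolynomial τ ℂ) :
    δ (aeval t p) = ∑ i, δ (t i) * aeval t (pderiv i p) := by
  induction p using MvPolynomial.induction_on with
  | C a => simp
  | add p q hp hq => simp only [map_add, hp, hq, mul_add, Finset.sum_add_distrib]
  | mul_X p i hp =>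
    classical
    rw [map_mul, Derivation.leibniz, hp, aeval_X]
    simp only [Derivation.leibniz, smul_eq_mul, map_add, map_mul, aeval_X, mul_add,
      Finset.sum_add_distrib, Finset.mul_sum, pderiv_X]
    congr 1
    · rw [Finset.sum_eq_single i]
      · simp; ring
      · intro j _ hj; simp [hj.symm]
      · simp
    · exact Finset.sum_congr rfl fun _ _ => by ring

/-- Base change as a linear map in coordinates. -/
def conjEnd {R : Type} [CommRing R] (g : ∀ x : Q.V, Matrix.GeneralLinearGroup (Fin (α x)) R) :
    (RepCoord (Q := Q) α → R) →ₗ[R] (RepCoord (Q := Q) α → R) where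
  toFun v := repEntries (gActR g fun a => Matrix.of fun i j => v ⟨a, i, j⟩)
  map_add' v w := by
    funext c
    have h {m n : ℕ} (A : Matrix (Fin m) (Fin m) R) (B C : Matrix (Fin m) (Fin n) R)
        (D : Matrix (Fin n) (Fin n) R) : A * (B + C) * D = A * B * D + A * C * D := by
      rw [Matrix.mul_add, Matrix.add_mul]
    exact congrFun (congrFun (h (g (Q.h c.1)).val (Matrix.of fun i j => v ⟨c.1, i, j⟩)
      (Matrix.of fun i j => w ⟨c.1, i, j⟩) ((g (Q.t c.1))⁻¹).val) c.2.1) c.2.2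
  map_smul' r v := by
    funext c
    have h {m n : ℕ} (A : Matrix (Fin m) (Fin m) R) (B : Matrix (Fin m) (Fin n) R)
        (D : Matrix (Fin n) (Fin n) R) : A * (r • B) * D = r • (A * B * D) := by
      rw [Matrix.mul_smul, Matrix.smul_mul]
    exact congrFun (congrFun (h (g (Q.h c.1)).val (Matrix.of fun i j => v ⟨c.1, i, j⟩)
      ((g (Q.t c.1))⁻¹).val) c.2.1) c.2.2

theorem gActR_gActR {R : Type} [CommRing R]
    (g h : ∀ x : Q.V, Matrix.GeneralLinearGroup (Fin (α x)) R) (W : RepR Q R α) :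
    gActR g (gActR h W) = gActR (g * h) W := by
  funext a
  simp only [gActR, Pi.mul_apply, _root_.mul_inv_rev, Units.val_mul, Matrix.mul_assoc]

theorem gActR_one {R : Type} [CommRing R] (W : RepR Q R α) : gActR 1 W = W := by
  funext a
  simp [gActR]

theorem conjEnd_injective {R : Type} [CommRing R]
    (g : ∀ x : Q.V, Matrix.GeneralLinearGroup (Fin (α x)) R) : Function.Injective (conjEnd g) := by
  have h : ∀ v, conjEnd g⁻¹ (conjEnd g v) = v := by
    intro v
    have := (gActR_gActR g⁻¹ g (fun a => Matrix.of fun i j => v ⟨a, i, j⟩)).trans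
      ((congrArg (gActR · _) (inv_mul_cancel g)).trans (gActR_one _))
    exact congrArg repEntries this
  exact Function.LeftInverse.injective h

section Field

variable {K : Type} [Field K] [Algebra ℂ K]

theorem derivation_gActR (δ : Derivation ℂ K K)
    (G : ∀ x : Q.V, Matrix.GeneralLinearGroup (Fin (α x)) K) (N : RepR Q K α) :
    derValues (repEntries (gActR G N)) δ = conjEnd G
      (dEnd N (fun v => (((G v.1)⁻¹).val * (G v.1).val.map δ) v.2.1 v.2.2) +
        repEntries (mapRep δ N)) := by
  funext ⟨a, i, j⟩
  have key : (gActR G N a).map δ = (G (Q.h a)).val *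
      (((G (Q.h a))⁻¹.val * (G (Q.h a)).val.map δ) * N a -
        N a * ((G (Q.t a))⁻¹.val * (G (Q.t a)).val.map δ) + (N a).map δ) * ((G (Q.t a))⁻¹).val := by
    have h {m n : ℕ} (G G' D : Matrix (Fin m) (Fin m) K) (A B : Matrix (Fin m) (Fin n) K)
        (H' E : Matrix (Fin n) (Fin n) K) (hG : G * G' = 1) :
        G * A * -(H' * E * H') + (G * B + D * A) * H' =
          G * (G' * D * A - A * (H' * E) + B) * H' := by
      have h1 : G * (G' * D * A) = D * A := by
        rw [← Matrix.mul_assoc, ← Matrix.mul_assoc, hG, Matrix.one_mul]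
      rw [Matrix.mul_add, Matrix.mul_sub, h1]
      simp only [Matrix.add_mul, Matrix.sub_mul, Matrix.mul_assoc, Matrix.mul_neg]
      abel
    rw [gActR, δ.map_matrix_mul, δ.map_matrix_mul, δ.map_matrix_inv]
    exact h _ _ _ _ _ _ _ (by rw [← Units.val_mul, mul_inv_cancel, Units.val_one])
  exact congrFun (congrFun key i) j

/-- The dimension of the tangent image at the generic point of a family of orbits. -/
theorem derRank_gActR_le {τ : Type} [Fintype τ] [Fintype Q.A] (t : τ → K)
    (G : ∀ x : Q.V, Matrix.GeneralLinearGroup (Fin (α x)) K)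
    (N : RepR Q (MvPolynomial τ ℂ) α) :
    derRank (repEntries (gActR G (mapRep (aeval t) N))) ≤
      dRank (mapRep (aeval t) N) + Fintype.card τ := by
  let w : τ → RepCoord (Q := Q) α → K :=
    fun i => repEntries (mapRep (aeval t) (mapRep (pderiv i) N))
  have h : LinearMap.range (derValues (repEntries (gActR G (mapRep (aeval t) N)))) ≤
      (LinearMap.range (dEnd (mapRep (aeval t) N)) ⊔ Submodule.span K (Set.range w)).map
        (conjEnd G) := by
    rintro _ ⟨δ, rfl⟩
    rw [derivation_gActR]
    refine Submodule.mem_map_of_mem (Submodule.add_mem_sup ⟨_, rfl⟩ ?_)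
    have : repEntries (mapRep δ (mapRep (aeval t) N)) = ∑ i, δ (t i) • w i := by
      funext c
      rw [Finset.sum_apply]
      exact δ.map_mvPolynomial_aeval t _
    rw [this]
    exact Submodule.sum_mem _ fun i _ => Submodule.smul_mem _ _ (Submodule.subset_span ⟨i, rfl⟩)
  calc _ ≤ _ := Submodule.finrank_mono h
    _ ≤ _ := Submodule.finrank_map_le _ _
    _ ≤ _ := Submodule.finrank_add_le_finrank_add_finrank _ _
    _ ≤ _ := Nat.add_le_add_left (finrank_range_le_card w) _

theorem dRank_le_derRank_gActR {τ : Type} [Fintype τ] [Fintype Q.A] (t : τ → K)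
    (G : ∀ x : Q.V, Matrix.GeneralLinearGroup (Fin (α x)) K)
    (hG : AlgebraicIndependent ℂ (Sum.elim (fun v : VCoord α => (G v.1).val v.2.1 v.2.2) t))
    (N : RepR Q (MvPolynomial τ ℂ) α) :
    dRank (mapRep (aeval t) N) ≤ derRank (repEntries (gActR G (mapRep (aeval t) N))) := by
  have h : (LinearMap.range (dEnd (mapRep (aeval t) N))).map (conjEnd G) ≤
      LinearMap.range (derValues (repEntries (gActR G (mapRep (aeval t) N)))) := by
    rintro _ ⟨_, ⟨ξ, rfl⟩, rfl⟩
    obtain ⟨δ, hδ⟩ := exists_derivation_of_algebraicIndependent hG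
      (Sum.elim (fun v => ((G v.1).val * Matrix.of fun i j => ξ ⟨v.1, i, j⟩) v.2.1 v.2.2) 0)
    have ht : ∀ i, δ (t i) = 0 := fun i => hδ (Sum.inr i)
    have hg : ∀ x, (G x).val.map δ = (G x).val * Matrix.of fun i j => ξ ⟨x, i, j⟩ := by
      intro x
      ext i j
      exact hδ (Sum.inl ⟨x, i, j⟩)
    refine ⟨δ, ?_⟩
    rw [derivation_gActR]
    have h2 : repEntries (mapRep δ (mapRep (aeval t) N)) = 0 := by
      funext c
      refine (δ.map_mvPolynomial_aeval t _).trans ?_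
      simp [ht]
    rw [h2, add_zero]
    congr 2
    funext v
    rw [hg, ← Matrix.mul_assoc, ← Units.val_mul, inv_mul_cancel, Units.val_one, Matrix.one_mul]
    rfl
  calc _ = _ := 
      (Submodule.equivMapOfInjective _ (conjEnd_injective G) _).finrank_eq
    _ ≤ _ := Submodule.finrank_mono h

end Field

theorem exists_generic_point {τ : Type} [Finite τ] :
    ∃ (B K : Type) (_ : CommRing B) (_ : Algebra ℂ B) (_ : IsDomain B) (_ : Algebra.FiniteType ℂ B)
      (_ : Field K) (_ : Algebra ℂ K) (φ : B →ₐ[ℂ] K) (t : τ → K)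
      (G : ∀ x : Q.V, Matrix.GeneralLinearGroup (Fin (α x)) K), Function.Injective φ ∧
      AlgebraicIndependent ℂ (Sum.elim (fun v : VCoord α => (G v.1).val v.2.1 v.2.2) t) ∧
      ∀ N : RepR Q (MvPolynomial τ ℂ) α, ∃ η : RepR Q B α, famSet N = repImage η ∧
        mapRep φ η = gActR G (mapRep (aeval t) N) := by
  let B := Localization.Away (univDet α τ)
  have hB : IsDomain B := isDomain_GLRing α τ B
  let K := FractionRing B
  let φ : B →ₐ[ℂ] K := IsScalarTower.toAlgHom ℂ B K
  have hφ : Function.Injective φ := IsFractionRing.injective B K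
  let t : τ → K := fun i => φ (paramHom α τ B (X i))
  have ht : φ.comp (paramHom α τ B) = aeval t := aeval_unique _
  refine ⟨B, K, inferInstance, inferInstance, hB, finiteType_GLRing α τ, inferInstance,
    inferInstance, φ, t, fun x => Matrix.GeneralLinearGroup.map (φ : B →+* K) (univGL α τ B x),
    hφ, ?_, fun N => ⟨univFam B N, famSet_eq B N, ?_⟩⟩
  · let Φ : MatRing α τ →ₐ[ℂ] K := φ.comp (IsScalarTower.toAlgHom ℂ (MatRing α τ) B)
    have hΦ : Function.Injective Φ := hφ.comp (algebraMap_GLRing_injective α τ B)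
    have h := (MvPolynomial.algebraicIndependent_X (VCoord α ⊕ τ) ℂ).map' hΦ
    refine (algebraicIndependent_equiv' (Equiv.refl _) ?_).1 h
    funext v
    rcases v with v | i
    · rfl
    · change Φ (rename Sum.inr (X i)) = _
      rw [rename_X]
      rfl
  · refine (mapRep_gActR (φ : B →+* K) _ _).trans (congrArg (gActR _) ?_)
    funext a
    ext i j
    exact congrArg (fun f : MvPolynomial τ ℂ →ₐ[ℂ] K => f (N a i j)) ht

theorem zdim_zclosure_famSet_le {τ : Type} [Fintype τ] [Fintype Q.A]
    (N : RepR Q (MvPolynomial τ ℂ) α) {ρ : ℕ} (h : ∀ c, dRank (mapRep (eval c) N) ≤ ρ) :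
    zdim (zclosure (famSet N)) ≤ (ρ : WithBot ℕ∞) + (Fintype.card τ : WithBot ℕ∞) := by
  obtain ⟨B, K, _, _, _, _, _, _, φ, t, G, hφ, -, hN⟩ := exists_generic_point (α := α) (τ := τ)
  obtain ⟨η, h1, h2⟩ := hN N
  rw [h1, zdim_zclosure_repImage η φ hφ, h2]
  have h3 : derRank (repEntries (gActR G (mapRep (aeval t) N))) ≤ ρ + Fintype.card τ :=
    (derRank_gActR_le t G N).trans
      (Nat.add_le_add_right (dRank_map_le N (aeval t : MvPolynomial τ ℂ →ₐ[ℂ] K).toRingHom h) _)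
  exact_mod_cast h3

theorem famSet_map_C (V : QRep Q α) :
    famSet (mapRep (C : ℂ → MvPolynomial Empty ℂ) V) = orbitOf V := by
  have h : ∀ c : Empty → ℂ, mapRep (eval c) (mapRep (C : ℂ → MvPolynomial Empty ℂ) V) = V := by
    intro c
    funext a
    ext i j
    exact eval_C _
  ext W
  exact ⟨fun ⟨c, hc⟩ => by rwa [h c] at hc, fun hW => ⟨Empty.elim, by rwa [h]⟩⟩

/-- The dimension of an orbit is the rank of the tangent map of the action. -/
theorem zdim_orbitOf [Fintype Q.A] (V : QRep Q α) : zdim (orbitOf V) = dRank V := by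
  apply le_antisymm
  · have h := zdim_zclosure_famSet_le (mapRep (C : ℂ → MvPolynomial Empty ℂ) V) (ρ := dRank V)
      (by
        intro c
        refine le_of_eq (congrArg dRank ?_)
        funext a
        ext i j
        exact eval_C _)
    rw [famSet_map_C, Fintype.card_empty] at h
    refine (zdim_mono (subset_zclosure _)).trans (h.trans (le_of_eq ?_))
    simp
  · obtain ⟨B, K, _, _, _, _, _, _, φ, t, G, hφ, hG, hN⟩ :=
      exists_generic_point (α := α) (τ := Empty)
    obtain ⟨η, h1, h2⟩ := hN (mapRep C V)
    rw [← famSet_map_C, h1]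
    refine le_trans ?_ (derRank_le_zdim_repImage η φ hφ)
    rw [h2]
    have h3 : mapRep (aeval t : MvPolynomial Empty ℂ → K) (mapRep C V) =
        mapRep (algebraMap ℂ K) V := by
      funext a
      ext i j
      exact aeval_C _ _
    have h4 := dRank_le_derRank_gActR t G hG (mapRep C V)
    rw [h3] at h4 ⊢
    have h5 := (dRank_le_map V (algebraMap ℂ K)).trans h4
    exact_mod_cast h5

end OrbitDimension

section Modules

variable {Q : Quiv}

theorem evalPath_mapRep {R S : Type} [CommRing R] [CommRing S] {β : Q.V → ℕ} (φ : R →+* S)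
    (W : RepR Q R β) {x y : Q.V} (p : Quiver.Path x y) :
    evalPath (mapRep φ W) p = (evalPath W p).map φ := by
  induction p with
  | nil =>
    simp only [evalPath]
    exact (Matrix.map_one φ φ.map_zero φ.map_one).symm
  | cons p e ih =>
    rw [evalPath, evalPath, ih, Matrix.map_mul]
    rfl

theorem evalPath_comm {α γ : Q.V → ℕ} {V : QRep Q α} {W : QRep Q γ}
    {φ : ∀ x : Q.V, Matrix (Fin (γ x)) (Fin (α x)) ℂ} (hφ : φ ∈ HomS V W) {x y : Q.V}
    (p : Quiver.Path x y) : φ y * evalPath V p = evalPath W p * φ x := by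
  induction p with
  | nil => simp only [evalPath, Matrix.mul_one, Matrix.one_mul]
  | cons p e ih =>
    obtain ⟨a, rfl, rfl⟩ := e
    have h : φ (Q.h a) * V a = W a * φ (Q.t a) := hφ a
    rw [evalPath, evalPath]
    change φ (Q.h a) * (V a * evalPath V p) = (W a * evalPath W p) * φ _
    rw [← Matrix.mul_assoc, h, Matrix.mul_assoc, ih, Matrix.mul_assoc]

theorem evalLin_comm {α γ : Q.V → ℕ} {V : QRep Q α} {W : QRep Q γ}
    {φ : ∀ x : Q.V, Matrix (Fin (γ x)) (Fin (α x)) ℂ} (hφ : φ ∈ HomS V W) {x y : Q.V}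
    (c : Quiver.Path x y →₀ ℂ) : φ y * evalLin V c = evalLin W c * φ x := by
  simp only [evalLin, Finsupp.sum, Matrix.mul_sum, Matrix.sum_mul, Matrix.mul_smul,
    Matrix.smul_mul, evalPath_comm hφ]

theorem evalLin_polyEvalAt {γ : Q.V → ℕ} (M : RepR Q (Polynomial ℂ) γ) (lam : ℂ) {x y : Q.V}
    (c : Quiver.Path x y →₀ ℂ) :
    evalLin (polyEvalAt M lam) c = (evalLinP M c).map (Polynomial.eval lam) := by
  have h : ∀ p : Quiver.Path x y, evalPath (polyEvalAt M lam) p =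
    (evalPath M p).map (Polynomial.eval lam) := evalPath_mapRep (Polynomial.evalRingHom lam) M
  ext i j
  simp only [evalLin, evalLinP, Finsupp.sum, Matrix.sum_apply, Matrix.map_apply,
    Polynomial.eval_finsetSum, h, Matrix.smul_apply, smul_eq_mul, Polynomial.eval_mul,
    Polynomial.eval_C]

theorem zIsClosed_modSet (S : Set (FormalRel Q)) (β : Q.V → ℕ) : zIsClosed (modSet S β) := by
  let P : (r : FormalRel Q) → Fin (β r.2.1) → Fin (β r.1) → MvPolynomial (RepCoord (Q := Q) β) ℂ :=
    fun r i j => r.2.2.sum fun p k => MvPolynomial.C k * evalPath (univRep β) p i j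
  have hP : ∀ r i j W, repEval W (P r i j) = evalLin W r.2.2 i j := by
    intro r i j W
    have h : ∀ p : Quiver.Path r.1 r.2.1, (evalPath (univRep β) p).map
        (MvPolynomial.eval (repCoords W)) = evalPath W p := by
      intro p
      rw [← evalPath_mapRep, mapRep_univRep]
    simp only [P, repEval, Finsupp.sum, evalLin, map_sum, map_mul, MvPolynomial.eval_C,
      Matrix.sum_apply, Matrix.smul_apply, smul_eq_mul, ← h, Matrix.map_apply]
  have : modSet S β = {W | ∀ p ∈ {p | ∃ r ∈ S, ∃ i j, p = P r i j}, repEval W p = 0} := by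
    ext W
    constructor
    · rintro h _ ⟨r, hr, i, j, rfl⟩
      rw [hP, h r hr]
      rfl
    · intro h r hr
      ext i j
      rw [← hP]
      exact h _ ⟨r, hr, i, j, rfl⟩
  rw [this]
  exact zIsClosed_zero _

theorem HomS_inv {α γ : Q.V → ℕ} {V : QRep Q α} {W : QRep Q γ}
    {φ : ∀ x : Q.V, Matrix (Fin (γ x)) (Fin (α x)) ℂ} (hφ : φ ∈ HomS V W)
    {ψ : ∀ x : Q.V, Matrix (Fin (α x)) (Fin (γ x)) ℂ} (h1 : ∀ x, ψ x * φ x = 1)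
    (h2 : ∀ x, φ x * ψ x = 1) : ψ ∈ HomS W V := by
  intro a
  have : φ (Q.h a) * V a = W a * φ (Q.t a) := hφ a
  calc ψ (Q.h a) * W a = ψ (Q.h a) * (W a * φ (Q.t a)) * ψ (Q.t a) := by
        rw [Matrix.mul_assoc, Matrix.mul_assoc, h2, Matrix.mul_one]
    _ = V a * ψ (Q.t a) := by rw [← this, ← Matrix.mul_assoc, h1, Matrix.one_mul]

theorem HomS_mul {α β γ : Q.V → ℕ} {U : QRep Q α} {V : QRep Q β} {W : QRep Q γ}
    {φ : ∀ x : Q.V, Matrix (Fin (β x)) (Fin (α x)) ℂ} (hφ : φ ∈ HomS U V)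
    {ψ : ∀ x : Q.V, Matrix (Fin (γ x)) (Fin (β x)) ℂ} (hψ : ψ ∈ HomS V W) :
    (fun x => ψ x * φ x) ∈ HomS U W := by
  intro a
  have e1 : φ (Q.h a) * U a = V a * φ (Q.t a) := hφ a
  have e2 : ψ (Q.h a) * V a = W a * ψ (Q.t a) := hψ a
  change ψ (Q.h a) * φ (Q.h a) * U a = W a * (ψ (Q.t a) * φ (Q.t a))
  rw [Matrix.mul_assoc, e1, ← Matrix.mul_assoc, e2, Matrix.mul_assoc]

theorem rIso_of_inverse {α γ : Q.V → ℕ} {V : QRep Q α} {W : QRep Q γ}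
    {φ : ∀ x : Q.V, Matrix (Fin (γ x)) (Fin (α x)) ℂ} (hφ : φ ∈ HomS V W)
    {ψ : ∀ x : Q.V, Matrix (Fin (α x)) (Fin (γ x)) ℂ} (h1 : ∀ x, ψ x * φ x = 1)
    (h2 : ∀ x, φ x * ψ x = 1) : RIso V W := by
  refine ⟨fun x => LinearEquiv.ofLinearMap (φ x).mulVecLin (ψ x).mulVecLin ?_ ?_, fun a => ?_⟩
  · rw [← Matrix.mulVecLin_mul, h2, Matrix.mulVecLin_one]
  · rw [← Matrix.mulVecLin_mul, h1, Matrix.mulVecLin_one]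
  · have : φ (Q.h a) * V a = W a * φ (Q.t a) := hφ a
    change (φ _).mulVecLin ∘ₗ _ = _ ∘ₗ (φ _).mulVecLin
    rw [← Matrix.mulVecLin_mul, ← Matrix.mulVecLin_mul, this]

theorem RIso.exists_inverse {α γ : Q.V → ℕ} {V : QRep Q α} {W : QRep Q γ} (h : RIso V W) :
    ∃ φ ∈ HomS V W, ∃ ψ ∈ HomS W V, (∀ x, ψ x * φ x = 1) ∧ ∀ x, φ x * ψ x = 1 := by
  obtain ⟨u, hu⟩ := h
  have hφ : (fun x => LinearMap.toMatrix' (u x).toLinearMap) ∈ HomS V W := by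
    intro a
    have := congrArg LinearMap.toMatrix' (hu a)
    rw [LinearMap.toMatrix'_comp, LinearMap.toMatrix'_comp] at this
    simpa only [← Matrix.toLin'_apply', LinearMap.toMatrix'_toLin'] using this
  have h1 : ∀ x, LinearMap.toMatrix' (u x).symm.toLinearMap *
      LinearMap.toMatrix' (u x).toLinearMap = 1 := fun x => by
    rw [← LinearMap.toMatrix'_comp]
    simp
  have h2 : ∀ x, LinearMap.toMatrix' (u x).toLinearMap *
      LinearMap.toMatrix' (u x).symm.toLinearMap = 1 := fun x => by
    rw [← LinearMap.toMatrix'_comp]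
    simp
  exact ⟨_, hφ, _, HomS_inv hφ h1 h2, h1, h2⟩

theorem RIso.dim_eq {α γ : Q.V → ℕ} {V : QRep Q α} {W : QRep Q γ} (h : RIso V W) : α = γ := by
  obtain ⟨u, -⟩ := h
  funext x
  simpa using (u x).finrank_eq

theorem RIso.refl {α : Q.V → ℕ} (V : QRep Q α) : RIso V V :=
  ⟨fun _ => LinearEquiv.refl _ _, fun _ => rfl⟩

theorem RIso.symm {α γ : Q.V → ℕ} {V : QRep Q α} {W : QRep Q γ} (h : RIso V W) : RIso W V := by
  obtain ⟨φ, hφ, ψ, hψ, h1, h2⟩ := h.exists_inverse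
  exact rIso_of_inverse hψ h2 h1

theorem RIso.trans {α β γ : Q.V → ℕ} {U : QRep Q α} {V : QRep Q β} {W : QRep Q γ}
    (h : RIso U V) (h' : RIso V W) : RIso U W := by
  obtain ⟨u, hu⟩ := h
  obtain ⟨v, hv⟩ := h'
  refine ⟨fun x => (u x).trans (v x), fun a => ?_⟩
  rw [LinearEquiv.coe_trans, LinearEquiv.coe_trans, LinearMap.comp_assoc, hu,
    ← LinearMap.comp_assoc, hv, LinearMap.comp_assoc]

theorem RIso.mem_modSet {S : Set (FormalRel Q)} {α γ : Q.V → ℕ} {V : QRep Q α} {W : QRep Q γ}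
    (h : RIso V W) (hV : V ∈ modSet S α) : W ∈ modSet S γ := by
  obtain ⟨φ, hφ, ψ, -, -, h2⟩ := h.exists_inverse
  intro r hr
  have h3 := evalLin_comm hφ r.2.2
  rw [hV r hr, Matrix.mul_zero] at h3
  calc evalLin W r.2.2 = evalLin W r.2.2 * φ r.1 * ψ r.1 := by
        rw [Matrix.mul_assoc, h2, Matrix.mul_one]
    _ = 0 := by rw [← h3, Matrix.zero_mul]

theorem mem_orbitOf_iff {α : Q.V → ℕ} {V W : QRep Q α} : W ∈ orbitOf V ↔ RIso V W := by
  constructor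
  · rintro ⟨g, rfl⟩
    refine rIso_of_inverse (φ := fun x => (g x).val) (ψ := fun x => ((g x)⁻¹).val)
      (fun a => ?_) (fun x => ?_) (fun x => ?_)
    · change _ = (g (Q.h a)).val * V a * ((g (Q.t a))⁻¹).val * (g (Q.t a)).val
      rw [Matrix.mul_assoc (_ * _), ← Units.val_mul, inv_mul_cancel, Units.val_one, Matrix.mul_one]
    · rw [← Units.val_mul, inv_mul_cancel, Units.val_one]
    · rw [← Units.val_mul, mul_inv_cancel, Units.val_one]
  · intro h
    obtain ⟨φ, hφ, ψ, -, h1, h2⟩ := h.exists_inverse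
    refine ⟨fun x => ⟨φ x, ψ x, h2 x, h1 x⟩, ?_⟩
    funext a
    have : φ (Q.h a) * V a = W a * φ (Q.t a) := hφ a
    change φ (Q.h a) * V a * ψ (Q.t a) = W a
    rw [this, Matrix.mul_assoc, h2, Matrix.mul_one]

theorem RIso.orbitOf_eq {α : Q.V → ℕ} {V W : QRep Q α} (h : RIso V W) : orbitOf V = orbitOf W := by
  ext U
  rw [mem_orbitOf_iff, mem_orbitOf_iff]
  exact ⟨h.symm.trans, h.trans⟩

theorem RIso.dRank_eq [Fintype Q.A] {α : Q.V → ℕ} {V W : QRep Q α} (h : RIso V W) :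
    dRank V = dRank W := by
  have := zdim_orbitOf V
  rw [h.orbitOf_eq, zdim_orbitOf] at this
  exact_mod_cast this.symm

theorem RIso.isIndecRep {α : Q.V → ℕ} {V W : QRep Q α} (h : RIso V W) (hV : IsIndecRep V) :
    IsIndecRep W := by
  obtain ⟨φ, hφ, ψ, hψ, h1, h2⟩ := h.exists_inverse
  refine ⟨hV.1, fun θ hθ hid => ?_⟩
  have key : ∀ x, θ x = φ x * (ψ x * (θ x * φ x)) * ψ x := by
    intro x
    rw [← Matrix.mul_assoc (φ x), h2, Matrix.one_mul, Matrix.mul_assoc, h2, Matrix.mul_one]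
  rcases hV.2 (fun x => ψ x * (θ x * φ x)) (HomS_mul (HomS_mul hφ hθ) hψ) (fun x => by
      simp only [Matrix.mul_assoc]
      rw [← Matrix.mul_assoc (φ x) (ψ x), h2, Matrix.one_mul, ← Matrix.mul_assoc (θ x) (θ x),
        hid]) with h | h
  · left
    funext x
    rw [key x, congrFun h x]
    simp
  · right
    funext x
    rw [key x, congrFun h x, Matrix.mul_one, h2]

end Modules

section LineFamilies

variable {Q : Quiv} {α : Q.V → ℕ}

theorem mapRep_gAct_pullback {B : Type} [CommRing B] [Algebra ℂ B] (N : RepR Q B α) (g : GLb α)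
    (p : MvPolynomial (RepCoord (Q := Q) α) ℂ) :
    ∃ q : B, ∀ ψ : B →ₐ[ℂ] ℂ, ψ q = repEval (gAct g (mapRep ψ N)) p := by
  let g' : ∀ x : Q.V, Matrix.GeneralLinearGroup (Fin (α x)) B :=
    fun x => Matrix.GeneralLinearGroup.map (algebraMap ℂ B) (g x)
  refine ⟨MvPolynomial.aeval (repEntries (gActR g' N)) p, fun ψ => ?_⟩
  have h : mapRep ψ (gActR g' N) = gAct g (mapRep ψ N) := by
    have h1 := mapRep_gActR (ψ : B →+* ℂ) g' N
    refine h1.trans ?_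
    have h2 : (fun x => Matrix.GeneralLinearGroup.map (ψ : B →+* ℂ) (g' x)) = g := by
      funext x
      apply Units.ext
      ext i j
      exact ψ.commutes _
    rw [h2]
    rfl
  rw [← h, ← AlgHom.comp_apply, MvPolynomial.comp_aeval]
  rfl

/-- The representations isomorphic to a member of a family over the affine line. -/
def lineSet (F : RepR Q (Polynomial ℂ) α) : Set (QRep Q α) :=
  {W | ∃ lam, W ∈ orbitOf (polyEvalAt F lam)}

theorem exists_line_pullback (F : RepR Q (Polynomial ℂ) α) (g : GLb α)
    (p : MvPolynomial (RepCoord (Q := Q) α) ℂ) :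
    ∃ q : Polynomial ℂ, ∀ lam, q.eval lam = repEval (gAct g (polyEvalAt F lam)) p := by
  obtain ⟨q, hq⟩ := mapRep_gAct_pullback F g p
  refine ⟨q, fun lam => ?_⟩
  have := hq (Polynomial.aeval lam)
  rwa [Polynomial.coe_aeval_eq_eval] at this

theorem zIrred_zclosure_lineSet [Fintype Q.A] (F : RepR Q (Polynomial ℂ) α) :
    zIrred (zclosure (lineSet F)) := by
  have h : lineSet F =
      famSet (mapRep (Polynomial.aeval (MvPolynomial.X () : MvPolynomial Unit ℂ)) F) := by
    have h1 : ∀ c : Unit → ℂ, mapRep (MvPolynomial.eval c)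
        (mapRep (Polynomial.aeval (MvPolynomial.X () : MvPolynomial Unit ℂ)) F) =
        polyEvalAt F (c ()) := by
      intro c
      funext a
      ext i j
      change MvPolynomial.eval c (Polynomial.aeval _ (F a i j)) = Polynomial.eval _ (F a i j)
      rw [← Polynomial.coe_aeval_eq_eval, ← MvPolynomial.coe_aeval_eq_eval]
      change MvPolynomial.aeval c (Polynomial.aeval _ (F a i j)) = _
      rw [← Polynomial.aeval_algHom_apply, MvPolynomial.aeval_X]
    ext W
    constructor
    · rintro ⟨lam, h⟩
      exact ⟨fun _ => lam, by rwa [h1]⟩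
    · rintro ⟨c, h⟩
      exact ⟨c (), by rwa [h1] at h⟩
  rw [h]
  exact zIrred_zclosure_famSet _

theorem zIrred_zclosure_orbitOf [Fintype Q.A] (V : QRep Q α) : zIrred (zclosure (orbitOf V)) := by
  rw [← famSet_map_C]
  exact zIrred_zclosure_famSet _

theorem self_mem_orbitOf (V : QRep Q α) : V ∈ orbitOf V := mem_orbitOf_iff.2 (RIso.refl V)

theorem orbitOf_subset_modSet {S : Set (FormalRel Q)} {V : QRep Q α} (hV : V ∈ modSet S α) :
    orbitOf V ⊆ modSet S α := fun _ hW => (mem_orbitOf_iff.1 hW).mem_modSet hV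

theorem zIsOpen.inter_nonempty_of_zclosure {s U : Set (QRep Q α)} (hU : zIsOpen U) {W : QRep Q α}
    (hW : W ∈ zclosure s) (hWU : W ∈ U) : (s ∩ U).Nonempty := by
  have := mem_closure_iff.1 hW U hU hWU
  rwa [Set.inter_comm]

theorem zIrred.exists_subset {C : Set (QRep Q α)} (hC : zIrred C) {ι : Type} [Finite ι]
    {Z : ι → Set (QRep Q α)} (h : C ⊆ zclosure (⋃ i, Z i)) : ∃ i, C ⊆ zclosure (Z i) := by
  classical
  have := Fintype.ofFinite ι
  have h1 : zclosure (⋃ i, Z i) = ⋃ i, zclosure (Z i) := closure_iUnion_of_finite _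
  rw [h1] at h
  obtain ⟨z, hz, hCz⟩ := isIrreducible_iff_sUnion_isClosed.1 hC
    (Finset.univ.image fun i => zclosure (Z i))
    (by
      intro z hz
      obtain ⟨i, -, rfl⟩ := Finset.mem_image.1 hz
      exact zIsClosed_zclosure _)
    (by
      intro W hW
      obtain ⟨i, hi⟩ := Set.mem_iUnion.1 (h hW)
      exact ⟨_, by simp, hi⟩)
  obtain ⟨i, -, rfl⟩ := Finset.mem_image.1 hz
  exact ⟨i, hCz⟩

theorem polyEvalAt_map_C (V : QRep Q α) (lam : ℂ) :
    polyEvalAt (mapRep Polynomial.C V) lam = V := by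
  funext a
  ext i j
  exact Polynomial.eval_C

theorem lineSet_map_C (V : QRep Q α) : lineSet (mapRep Polynomial.C V) = orbitOf V := by
  ext W
  constructor
  · rintro ⟨lam, h⟩
    rwa [polyEvalAt_map_C] at h
  · intro h
    exact ⟨0, by rwa [polyEvalAt_map_C]⟩

theorem finite_not_isIndecRep {F : RepR Q (Polynomial ℂ) α} {M : Set (QRep Q α)}
    (h : IsIndecComp (zclosure (lineSet F)) M) :
    {lam | ¬ IsIndecRep (polyEvalAt F lam)}.Finite := by
  obtain ⟨⟨hirr, -⟩, U, hU, hd, hind⟩ := h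
  obtain ⟨W0, hW0⟩ := hirr.1
  obtain ⟨W1, hW1, hW1U⟩ := (closure_nonempty_iff.1 ⟨W0, hd hW0⟩ : (_ ∩ U).Nonempty)
  obtain ⟨_, ⟨lam0, g, rfl⟩, hU0⟩ := hU.inter_nonempty_of_zclosure hW1 hW1U
  obtain ⟨p, hp, hpU⟩ := hU.exists_poly hU0
  obtain ⟨q, hq⟩ := exists_line_pullback F g p
  have hq0 : q ≠ 0 := by
    rintro rfl
    rw [← hq] at hp
    simp at hp
  refine (q.rootSet_finite ℂ).subset fun lam hlam => ?_
  rw [Polynomial.mem_rootSet_of_ne hq0, Polynomial.coe_aeval_eq_eval]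
  by_contra hne
  rw [hq] at hne
  exact hlam ((mem_orbitOf_iff.1 ⟨g, rfl⟩ : RIso _ _).symm.isIndecRep
    (hind _ ⟨subset_zclosure _ ⟨lam, g, rfl⟩, hpU _ hne⟩))

theorem lineSet_subset_zclosure_orbitOf {F : RepR Q (Polynomial ℂ) α} {V : QRep Q α}
    (h : {lam | RIso V (polyEvalAt F lam)}.Infinite) : lineSet F ⊆ zclosure (orbitOf V) := by
  rintro _ ⟨lam, g, rfl⟩
  rw [mem_zclosure_iff]
  intro p hp
  obtain ⟨q, hq⟩ := exists_line_pullback F g p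
  have hq0 : q = 0 := by
    refine Polynomial.eq_zero_of_infinite_isRoot q (h.mono fun mu hmu => ?_)
    rw [Set.mem_ofPred_eq, Polynomial.IsRoot, hq]
    exact hp _ (mem_orbitOf_iff.2 (RIso.trans hmu (mem_orbitOf_iff.1 ⟨g, rfl⟩)))
  rw [← hq, hq0, Polynomial.eval_zero]

theorem exists_family_of_isTame [Fintype Q.A] {S : Set (FormalRel Q)} (htame : IsTame S)
    {C : Set (QRep Q α)} (hC : IsIndecComp C (modSet S α)) (hno : ¬ IsOrbitClosure S C) :
    ∃ F : RepR Q (Polynomial ℂ) α, C = zclosure (lineSet F) ∧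
      ∀ V : QRep Q α, {lam | RIso V (polyEvalAt F lam)}.Finite := by
  obtain ⟨⟨hirr, hcl, hsub, hmax⟩, U, hU, hd, hind⟩ := hC
  obtain ⟨s, γs, M, hM, t, βs, E, hE⟩ := htame (∑ x, α x)
  let Z : Fin t ⊕ Fin s → Set (QRep Q α) := Sum.elim
    (fun k => {V | V ∈ modSet S α ∧ RIso (E k) V})
    (fun i => {V | ∃ lam, RIso (polyEvalAt (M i) lam) V})
  have hCZ : C ⊆ zclosure (⋃ j, Z j) := by
    refine hd.trans (zclosure_mono fun V hV => ?_)
    rcases hE α V (hsub hV.1) rfl (hind V hV) with ⟨k, hk⟩ | ⟨i, hi⟩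
    · exact Set.mem_iUnion.2 ⟨Sum.inl k, hsub hV.1, hk⟩
    · exact Set.mem_iUnion.2 ⟨Sum.inr i, hi⟩
  obtain ⟨j, hj⟩ := hirr.exists_subset hCZ
  obtain ⟨W0, hW0⟩ := hirr.1
  have hne : (Z j).Nonempty := closure_nonempty_iff.1 ⟨W0, hj hW0⟩
  rcases j with k | i
  · obtain ⟨V, hV, hkV⟩ := hne
    refine (hno ⟨V, hV, (hmax _ (zIrred_zclosure_orbitOf V) (zIsClosed_zclosure _)
      (zclosure_minimal (orbitOf_subset_modSet hV) (zIsClosed_modSet S α)) ?_).symm⟩).elim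
    exact hj.trans (zclosure_mono fun W hW => mem_orbitOf_iff.2 (hkV.symm.trans hW.2))
  · obtain ⟨V, lam, hV⟩ := hne
    have key : ∀ {γ : Q.V → ℕ} (N : RepR Q (Polynomial ℂ) γ), γ = α →
        (∀ r ∈ S, evalLinP N r.2.2 = 0) →
        C ⊆ zclosure {V : QRep Q α | ∃ lam, RIso (polyEvalAt N lam) V} →
        ∃ F : RepR Q (Polynomial ℂ) α, C = zclosure (lineSet F) ∧ lineSet F ⊆ modSet S α := by
      rintro γ F rfl hF hCF
      have h1 : {V : QRep Q γ | ∃ lam, RIso (polyEvalAt F lam) V} = lineSet F := by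
        ext W
        exact exists_congr fun _ => mem_orbitOf_iff.symm
      have h2 : lineSet F ⊆ modSet S γ := by
        rintro W ⟨lam, hW⟩
        refine orbitOf_subset_modSet ?_ hW
        intro r hr
        rw [evalLin_polyEvalAt, hF r hr]
        ext i j
        simp
      rw [h1] at hCF
      exact ⟨F, (hmax _ (zIrred_zclosure_lineSet F) (zIsClosed_zclosure _)
        (zclosure_minimal h2 (zIsClosed_modSet S γ)) hCF).symm, h2⟩
    obtain ⟨F, hF, hFm⟩ := key (M i) hV.dim_eq (hM i) hj
    refine ⟨F, hF, fun V => ?_⟩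
    by_contra hinf
    obtain ⟨lam, hlam⟩ := Set.Infinite.nonempty hinf
    have hVm : orbitOf V ⊆ lineSet F := fun W hW =>
      ⟨lam, mem_orbitOf_iff.2 (RIso.trans (RIso.symm hlam) (mem_orbitOf_iff.1 hW))⟩
    refine hno ⟨V, hFm (hVm (self_mem_orbitOf V)), ?_⟩
    rw [hF]
    exact (zclosure_minimal (lineSet_subset_zclosure_orbitOf hinf)
      (zIsClosed_zclosure _)).antisymm (zclosure_mono hVm)

end LineFamilies

section KrullSchmidt

variable {Q : Quiv}

theorem HomS_aeval {α : Q.V → ℕ} {V : QRep Q α}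
    {θ : ∀ x : Q.V, Matrix (Fin (α x)) (Fin (α x)) ℂ} (hθ : θ ∈ HomS V V) (p : Polynomial ℂ) :
    (fun x => Polynomial.aeval (θ x) p) ∈ HomS V V := by
  intro a
  have h : θ (Q.h a) * V a = V a * θ (Q.t a) := hθ a
  have hpow : ∀ n : ℕ, θ (Q.h a) ^ n * V a = V a * θ (Q.t a) ^ n := by
    intro n
    induction n with
    | zero => simp
    | succ n ih => rw [pow_succ, Matrix.mul_assoc, h, ← Matrix.mul_assoc, ih, Matrix.mul_assoc,
        ← pow_succ]
  change Polynomial.aeval (θ (Q.h a)) p * V a = V a * Polynomial.aeval (θ (Q.t a)) p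
  rw [Polynomial.aeval_eq_sum_range, Polynomial.aeval_eq_sum_range, Matrix.sum_mul,
    Matrix.mul_sum]
  exact Finset.sum_congr rfl fun n _ => by rw [Matrix.smul_mul, Matrix.mul_smul, hpow]

theorem IsIndecRep.isUnit_of_trace_ne_zero {α : Q.V → ℕ} {V : QRep Q α} (hV : IsIndecRep V)
    {θ : ∀ x : Q.V, Matrix (Fin (α x)) (Fin (α x)) ℂ} (hθ : θ ∈ HomS V V)
    (htr : ∑ x, (θ x).trace ≠ 0) (x : Q.V) : IsUnit (θ x) := by
  let p : Polynomial ℂ := Polynomial.X * ∏ x, (θ x).charpoly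
  have hp : ∀ x, Polynomial.aeval (θ x) p = 0 := by
    intro x
    obtain ⟨q, hq⟩ := Finset.dvd_prod_of_mem (fun x => (θ x).charpoly) (Finset.mem_univ x)
    simp only [p, hq, map_mul, Matrix.aeval_self_charpoly, zero_mul, mul_zero]
  have hp0 : p ≠ 0 := mul_ne_zero Polynomial.X_ne_zero
    (Finset.prod_ne_zero_iff.2 fun x _ => (Matrix.charpoly_monic _).ne_zero)
  obtain ⟨q, hpq, hq⟩ := Polynomial.exists_eq_pow_rootMultiplicity_mul_and_not_dvd p hp0 0
  rw [Polynomial.C_0, sub_zero] at hpq hq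
  set k := p.rootMultiplicity 0
  have hk : k ≠ 0 := by
    intro hk
    rw [hk, pow_zero, one_mul] at hpq
    exact hq (hpq ▸ Dvd.intro _ rfl)
  obtain ⟨k', hk'⟩ := Nat.exists_eq_succ_of_ne_zero hk
  have hcop : IsCoprime (Polynomial.X ^ k : Polynomial ℂ) q :=
    ((Polynomial.irreducible_X.coprime_iff_not_dvd).2 hq).pow_left
  obtain ⟨a, b, hab⟩ := hcop
  have hev : ∀ x, Polynomial.aeval (θ x) (a * Polynomial.X ^ k) +
      Polynomial.aeval (θ x) (b * q) = 1 := by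
    intro x
    rw [← map_add, hab, map_one]
  have hzero : ∀ x, Polynomial.aeval (θ x) (a * Polynomial.X ^ k) *
      Polynomial.aeval (θ x) (b * q) = 0 := by
    intro x
    rw [← map_mul, show a * Polynomial.X ^ k * (b * q) = a * b * p by rw [hpq]; ring, map_mul,
      hp x, mul_zero]
  rcases hV.2 _ (HomS_aeval hθ (a * Polynomial.X ^ k)) (fun x => by
      have := congrArg (Polynomial.aeval (θ x) (a * Polynomial.X ^ k) * ·) (hev x)
      simpa only [mul_add, hzero, add_zero, mul_one] using this) with h | h
  · refine (htr (Finset.sum_eq_zero fun y _ => ?_)).elim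
    have h1 : Polynomial.aeval (θ y) (b * q) = 1 := by
      have h2 := hev y
      rwa [congrFun h y, Pi.zero_apply, zero_add] at h2
    have h2 : θ y ^ k = 0 := by
      have h3 : θ y ^ k * Polynomial.aeval (θ y) (b * q) = 0 := by
        have : θ y ^ k = Polynomial.aeval (θ y) (Polynomial.X ^ k : Polynomial ℂ) := by simp
        rw [this, ← map_mul, show Polynomial.X ^ k * (b * q) = b * p by rw [hpq]; ring, map_mul,
          hp y, mul_zero]
      rwa [h1, mul_one] at h3
    exact (Matrix.isNilpotent_trace_of_isNilpotent ⟨k, h2⟩).eq_zero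
  · have h1 : Polynomial.aeval (θ x) (a * Polynomial.X ^ k) = 1 := congrFun h x
    rw [hk', pow_succ, ← mul_assoc, map_mul, Polynomial.aeval_X] at h1
    exact ⟨⟨θ x, _, mul_eq_one_comm.1 h1, h1⟩, rfl⟩

theorem rIso_of_trace_ne_zero {α β : Q.V → ℕ} {V : QRep Q α} {W : QRep Q β} (hV : IsIndecRep V)
    (hW : IsIndecRep W) {k : ∀ x : Q.V, Matrix (Fin (β x)) (Fin (α x)) ℂ} (hk : k ∈ HomS V W)
    {h : ∀ x : Q.V, Matrix (Fin (α x)) (Fin (β x)) ℂ} (hh : h ∈ HomS W V)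
    (htr : ∑ x, (h x * k x).trace ≠ 0) : RIso V W := by
  have h1 := hV.isUnit_of_trace_ne_zero (HomS_mul hk hh) htr
  have h2 := hW.isUnit_of_trace_ne_zero (HomS_mul hh hk)
    (by simpa only [Matrix.trace_mul_comm (k _)] using htr)
  choose u hu using fun x => (h1 x).exists_left_inv
  choose v hv using fun x => (h2 x).exists_right_inv
  have hl : ∀ x, (u x * h x) * k x = 1 := fun x => by rw [Matrix.mul_assoc, hu]
  have hr : ∀ x, k x * (h x * v x) = 1 := fun x => by rw [← Matrix.mul_assoc, hv]
  refine rIso_of_inverse hk hl fun x => ?_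
  have : u x * h x = h x * v x := by
    calc u x * h x = u x * h x * (k x * (h x * v x)) := by rw [hr, Matrix.mul_one]
      _ = h x * v x := by rw [← Matrix.mul_assoc, hl, Matrix.one_mul]
  rw [this, hr]

section DirectSum

variable {ι : Type} {α : Q.V → ℕ} {αs : ι → Q.V → ℕ}
  (e : ∀ x, (Σ i, Fin (αs i x)) ≃ Fin (α x))

/-- The direct sum of matrix representations, in coordinates. -/
def dsum [DecidableEq ι] {R : Type} [CommRing R] (V : ∀ i, RepR Q R (αs i)) : RepR Q R α :=
  fun a => (Matrix.blockDiagonal' fun i => V i a).submatrix (e (Q.h a)).symm (e (Q.t a)).symm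

theorem mapRep_dsum [DecidableEq ι] {R S : Type} [CommRing R] [CommRing S] (φ : R →+* S)
    (V : ∀ i, RepR Q R (αs i)) : mapRep φ (dsum e V) = dsum e fun i => mapRep φ (V i) := by
  funext a
  ext r c
  exact congrFun (congrFun (Matrix.blockDiagonal'_map (fun i => V i a) φ φ.map_zero) _) _

theorem isSumOf_iff_rIso [Fintype ι] [DecidableEq ι] {W : QRep Q α} {V : ∀ i, QRep Q (αs i)} :
    IsSumOf W V ↔ RIso (dsum e V) W := by
  let P : ∀ x, (Fin (α x) → ℂ) ≃ₗ[ℂ] ((Σ i, Fin (αs i x)) → ℂ) :=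
    fun x => LinearEquiv.funCongrLeft ℂ ℂ (e x)
  have hP : ∀ a, (P (Q.h a)).toLinearMap ∘ₗ (dsum e V a).mulVecLin =
      (Matrix.blockDiagonal' fun i => V i a).mulVecLin ∘ₗ (P (Q.t a)).toLinearMap := by
    intro a
    refine LinearMap.ext fun v => ?_
    change ((dsum e V a) *ᵥ v) ∘ (e (Q.h a)) = (Matrix.blockDiagonal' fun i => V i a) *ᵥ (v ∘ e _)
    rw [dsum, Matrix.submatrix_mulVec_equiv]
    funext c
    simp
  constructor
  · rintro ⟨u, hu⟩
    refine ⟨fun x => (P x).trans (u x).symm, fun a => LinearMap.ext fun v => ?_⟩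
    have h1 := LinearMap.congr_fun (hP a) v
    have h2 := LinearMap.congr_fun (hu a) ((u (Q.t a)).symm (P (Q.t a) v))
    change P (Q.h a) ((dsum e V a).mulVecLin v) = _ at h1
    change u (Q.h a) ((W a).mulVecLin ((u (Q.t a)).symm (P (Q.t a) v))) =
      (Matrix.blockDiagonal' fun i => V i a).mulVecLin
        (u (Q.t a) ((u (Q.t a)).symm (P (Q.t a) v))) at h2
    rw [LinearEquiv.apply_symm_apply] at h2
    change (u (Q.h a)).symm (P (Q.h a) ((dsum e V a).mulVecLin v)) =
      (W a).mulVecLin ((u (Q.t a)).symm (P (Q.t a) v))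
    rw [LinearEquiv.symm_apply_eq, h1, h2]
    rfl
  · rintro ⟨u, hu⟩
    refine ⟨fun x => (u x).symm.trans (P x), fun a => LinearMap.ext fun v => ?_⟩
    have h1 := LinearMap.congr_fun (hP a) ((u (Q.t a)).symm v)
    have h2 := LinearMap.congr_fun (hu a) ((u (Q.t a)).symm v)
    change u (Q.h a) ((dsum e V a).mulVecLin ((u (Q.t a)).symm v)) =
      (W a).mulVecLin (u (Q.t a) ((u (Q.t a)).symm v)) at h2
    rw [LinearEquiv.apply_symm_apply] at h2
    change P (Q.h a) ((u (Q.h a)).symm ((W a).mulVecLin v)) = _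
    rw [← h2, LinearEquiv.symm_apply_apply]
    exact h1

variable (i : ι)

/-- The inclusion of a summand. -/
def dincl (x : Q.V) : Matrix (Fin (α x)) (Fin (αs i x)) ℂ :=
  (1 : Matrix (Fin (α x)) (Fin (α x)) ℂ).submatrix id fun c => e x ⟨i, c⟩

/-- The projection onto a summand. -/
def dproj (x : Q.V) : Matrix (Fin (αs i x)) (Fin (α x)) ℂ :=
  (1 : Matrix (Fin (α x)) (Fin (α x)) ℂ).submatrix (fun c => e x ⟨i, c⟩) id

theorem dproj_mul_dincl (x : Q.V) : dproj e i x * dincl e i x = 1 := by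
  ext r c
  simp [dproj, dincl, Matrix.mul_apply, Matrix.one_apply]

theorem sum_dincl_mul_dproj [Fintype ι] (x : Q.V) : ∑ i, dincl e i x * dproj e i x = 1 := by
  ext r c
  obtain ⟨⟨j, r'⟩, rfl⟩ := (e x).surjective r
  simp only [Matrix.sum_apply, dproj, dincl, Matrix.mul_apply, Matrix.submatrix_apply, id,
    Matrix.one_apply, EmbeddingLike.apply_eq_iff_eq]
  rw [Finset.sum_eq_single j]
  · rw [Finset.sum_eq_single r']
    · simp
    · intro b _ hb
      simp [hb.symm]
    · simp
  · intro b _ hb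
    refine Finset.sum_eq_zero fun k _ => ?_
    rw [if_neg, zero_mul]
    exact fun h => hb (Sigma.mk.inj ((e x).injective h)).1.symm
  · simp

theorem dincl_mem [DecidableEq ι] (V : ∀ i, QRep Q (αs i)) : dincl e i ∈ HomS (V i) (dsum e V) := by
  intro a
  ext r c
  obtain ⟨⟨j, r'⟩, rfl⟩ := (e (Q.h a)).surjective r
  simp only [dsum, dincl, Matrix.mul_apply, Matrix.submatrix_apply, id, Matrix.one_apply,
    EmbeddingLike.apply_eq_iff_eq, mul_ite, mul_one, mul_zero, Finset.sum_ite_eq',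
    Finset.mem_univ, if_true, Equiv.symm_apply_apply, ite_mul, one_mul, zero_mul]
  by_cases hj : j = i
  · subst hj
    simp
  · rw [Matrix.blockDiagonal'_apply_ne _ _ _ hj]
    refine Finset.sum_eq_zero fun k _ => if_neg fun h => hj (congrArg Sigma.fst h)

theorem dproj_mem [DecidableEq ι] (V : ∀ i, QRep Q (αs i)) : dproj e i ∈ HomS (dsum e V) (V i) := by
  intro a
  ext r c
  obtain ⟨⟨j, c'⟩, rfl⟩ := (e (Q.t a)).surjective c
  simp only [dsum, dproj, Matrix.mul_apply, Matrix.submatrix_apply, id, Matrix.one_apply,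
    EmbeddingLike.apply_eq_iff_eq, mul_ite, mul_one, mul_zero, Finset.sum_ite_eq,
    Finset.mem_univ, if_true, Equiv.symm_apply_apply, ite_mul, one_mul, zero_mul]
  by_cases hj : i = j
  · subst hj
    simp
  · rw [Matrix.blockDiagonal'_apply_ne _ _ _ hj]
    refine (Finset.sum_eq_zero fun k _ => if_neg fun h => hj (congrArg Sigma.fst h)).symm

/-- An indecomposable direct summand is isomorphic to one of the indecomposable summands of any
decomposition. -/
theorem exists_rIso_of_rIso_dsum [Fintype ι] [DecidableEq ι] {V V' : ∀ i, QRep Q (αs i)}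
    (hV : ∀ i, IsIndecRep (V i))
    (h : RIso (dsum e V') (dsum e V)) (hi : IsIndecRep (V' i)) :
    ∃ j, RIso (V' i) (V j) := by
  obtain ⟨φ, hφ, ψ, hψ, h1, h2⟩ := h.exists_inverse
  have hsum : ∑ j, ∑ x, ((dproj e i x * ψ x * dincl e j x) *
      (dproj e j x * (φ x * dincl e i x))).trace ≠ 0 := by
    rw [Finset.sum_comm]
    have : ∀ x, ∑ j, ((dproj e i x * ψ x * dincl e j x) *
        (dproj e j x * (φ x * dincl e i x))).trace = (αs i x : ℂ) := by
      intro x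
      have h3 : ∀ j, (dproj e i x * ψ x * dincl e j x) * (dproj e j x * (φ x * dincl e i x)) =
          dproj e i x * ψ x * (dincl e j x * dproj e j x) * (φ x * dincl e i x) := by
        intro j
        simp only [Matrix.mul_assoc]
      simp only [h3]
      rw [← Matrix.trace_sum, ← Matrix.sum_mul, ← Matrix.mul_sum, sum_dincl_mul_dproj,
        Matrix.mul_one, Matrix.mul_assoc, ← Matrix.mul_assoc (ψ x), h1, Matrix.one_mul,
        dproj_mul_dincl, Matrix.trace_one, Fintype.card_fin]
    simp only [this]
    obtain ⟨x, hx⟩ := hi.1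
    have : (∑ x, αs i x) ≠ 0 := fun h0 =>
      hx (Finset.sum_eq_zero_iff.1 h0 x (Finset.mem_univ x))
    exact_mod_cast this
  obtain ⟨j, -, hj⟩ := Finset.exists_ne_zero_of_sum_ne_zero hsum
  refine ⟨j, rIso_of_trace_ne_zero hi (hV j) (HomS_mul (HomS_mul (dincl_mem e i V') hφ)
    (dproj_mem e j V)) (HomS_mul (dincl_mem e j V) (HomS_mul hψ (dproj_mem e i V'))) hj⟩

end DirectSum

end KrullSchmidt

section SumFamilies

variable {Q : Quiv} {ι : Type} [DecidableEq ι] {α : Q.V → ℕ} {αs : ι → Q.V → ℕ}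
  (e : ∀ x, (Σ i, Fin (αs i x)) ≃ Fin (α x)) (F : ∀ i, RepR Q (Polynomial ℂ) (αs i))

/-- The direct sum of members of one-parameter families. -/
def nf (μ : ι → ℂ) : QRep Q α := dsum e fun i => polyEvalAt (F i) (μ i)

/-- The direct sum of one-parameter families. -/
def nfFamily : RepR Q (MvPolynomial ι ℂ) α :=
  dsum e fun i => mapRep (Polynomial.aeval (MvPolynomial.X i : MvPolynomial ι ℂ)) (F i)

theorem mapRep_nfFamily {μ : ι → ℂ} (ψ : MvPolynomial ι ℂ →ₐ[ℂ] ℂ)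
    (hψ : ∀ i, ψ (MvPolynomial.X i) = μ i) : mapRep ψ (nfFamily e F) = nf e F μ := by
  refine (mapRep_dsum e (ψ : MvPolynomial ι ℂ →+* ℂ) _).trans (congrArg _ (funext fun i => ?_))
  funext a
  ext r c
  change ψ (Polynomial.aeval _ (F i a r c)) = Polynomial.eval (μ i) (F i a r c)
  rw [← Polynomial.aeval_algHom_apply, hψ, Polynomial.coe_aeval_eq_eval]

theorem exists_nf_pullback (g : GLb α) (p : MvPolynomial (RepCoord (Q := Q) α) ℂ) :
    ∃ q : MvPolynomial ι ℂ, ∀ μ, MvPolynomial.eval μ q = repEval (gAct g (nf e F μ)) p := by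
  obtain ⟨q, hq⟩ := mapRep_gAct_pullback (nfFamily e F) g p
  refine ⟨q, fun μ => ?_⟩
  have := hq (MvPolynomial.aeval μ)
  rwa [mapRep_nfFamily e F (μ := μ) _ (fun i => MvPolynomial.aeval_X _ _)] at this

/-- The representations isomorphic to a direct sum of members of one-parameter families, where
the parameters outside `s` are prescribed. -/
def nfSet (s : Finset ι) (c : ι → ℂ) : Set (QRep Q α) :=
  {W | ∃ μ : ι → ℂ, (∀ i ∉ s, μ i = c i) ∧ RIso (nf e F μ) W}

/-- The polynomial family underlying `nfSet`. -/
def nfSubfamily (s : Finset ι) (c : ι → ℂ) : RepR Q (MvPolynomial s ℂ) α :=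
  mapRep (MvPolynomial.aeval fun i : ι =>
    if h : i ∈ s then (MvPolynomial.X ⟨i, h⟩ : MvPolynomial s ℂ) else MvPolynomial.C (c i))
    (nfFamily e F)

theorem mapRep_nfSubfamily (s : Finset ι) (c : ι → ℂ) (c' : s → ℂ) :
    mapRep (MvPolynomial.eval c') (nfSubfamily e F s c) =
      nf e F fun i => if h : i ∈ s then c' ⟨i, h⟩ else c i := by
  rw [← MvPolynomial.coe_aeval_eq_eval]
  refine mapRep_nfFamily e F ((MvPolynomial.aeval c').comp (MvPolynomial.aeval _)) fun i => ?_
  rw [AlgHom.comp_apply, MvPolynomial.aeval_X]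
  split_ifs <;> simp

theorem nfSet_eq_famSet (s : Finset ι) (c : ι → ℂ) :
    nfSet e F s c = famSet (nfSubfamily e F s c) := by
  ext W
  constructor
  · rintro ⟨μ, hμ, hW⟩
    refine ⟨fun i => μ i, ?_⟩
    rw [mapRep_nfSubfamily, mem_orbitOf_iff]
    have : (fun i => if h : i ∈ s then μ i else c i) = μ := by
      funext i
      split_ifs with h
      · rfl
      · exact (hμ i h).symm
    simpa only [this] using hW
  · rintro ⟨c', hc'⟩
    rw [mapRep_nfSubfamily, mem_orbitOf_iff] at hc'
    exact ⟨_, fun i hi => dif_neg hi, hc'⟩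

theorem mem_nfSet_self (s : Finset ι) (c : ι → ℂ) : nf e F c ∈ nfSet e F s c :=
  ⟨c, fun _ _ => rfl, RIso.refl _⟩

theorem nfSet_mono {s t : Finset ι} (h : s ⊆ t) (c : ι → ℂ) : nfSet e F s c ⊆ nfSet e F t c :=
  fun _ ⟨μ, hμ, hW⟩ => ⟨μ, fun i hi => hμ i fun hi' => hi (h hi'), hW⟩

theorem rIso_dsum [Fintype ι] {V W : ∀ i, QRep Q (αs i)} (h : ∀ i, RIso (V i) (W i)) :
    RIso (dsum e V) (dsum e W) := by
  choose φ hφ ψ hψ h1 h2 using fun i => (h i).exists_inverse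
  let D : (∀ i x, Matrix (Fin (αs i x)) (Fin (αs i x)) ℂ) →
      ∀ x, Matrix (Fin (α x)) (Fin (α x)) ℂ := fun θ x =>
    (Matrix.blockDiagonal' fun i => θ i x).submatrix (e x).symm (e x).symm
  have hD : ∀ θ η x, D θ x * D η x = D (fun i x => θ i x * η i x) x := by
    intro θ η x
    simp only [D]
    rw [Matrix.submatrix_mul_equiv, ← Matrix.blockDiagonal'_mul]
  have hD1 : ∀ θ x, (∀ i, θ i x = 1) → D θ x = 1 := by
    intro θ x h
    simp only [D, h]
    rw [show (fun i => (1 : Matrix (Fin (αs i x)) (Fin (αs i x)) ℂ)) = 1 from rfl,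
      Matrix.blockDiagonal'_one, Matrix.submatrix_one_equiv]
  refine rIso_of_inverse (φ := D φ) (ψ := D ψ) ?_ (fun x => ?_) fun x => ?_
  · intro a
    change (Matrix.blockDiagonal' _).submatrix _ _ * (Matrix.blockDiagonal' _).submatrix _ _ =
      (Matrix.blockDiagonal' _).submatrix _ _ * (Matrix.blockDiagonal' _).submatrix _ _
    rw [Matrix.submatrix_mul_equiv, Matrix.submatrix_mul_equiv, ← Matrix.blockDiagonal'_mul,
      ← Matrix.blockDiagonal'_mul]
    congr 2
    funext i
    exact hφ i a
  · rw [hD]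
    exact hD1 (fun i x => ψ i x * φ i x) x fun i => h1 i x
  · rw [hD]
    exact hD1 (fun i x => φ i x * ψ i x) x fun i => h2 i x

theorem gAct_dsum_mem_zclosure [Fintype ι] [Fintype Q.A] (c : ι → ℂ) (s : Finset ι) :
    ∀ V : ∀ i, QRep Q (αs i), (∀ i ∈ s, V i ∈ zclosure (lineSet (F i))) →
      (∀ i ∉ s, V i ∈ lineSet (F i)) →
      ∀ g : GLb α, gAct g (dsum e V) ∈ zclosure (nfSet e F Finset.univ c) := by
  induction s using Finset.induction_on with
  | empty =>
    intro V _ hV g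
    choose μ hμ using fun i => hV i (Finset.notMem_empty i)
    refine subset_zclosure _ ⟨μ, fun i hi => (hi (Finset.mem_univ i)).elim, ?_⟩
    exact (rIso_dsum e fun i => mem_orbitOf_iff.1 (hμ i)).trans (mem_orbitOf_iff.1 ⟨g, rfl⟩)
  | insert k s hk ih =>
    intro V hVs hV g
    rw [mem_zclosure_iff]
    intro p hp
    obtain ⟨q, hq⟩ := mapRep_gAct_pullback (dsum e (Function.update
      (fun i => mapRep (MvPolynomial.C (R := ℂ) (σ := RepCoord (Q := Q) (αs k))) (V i)) k
      (univRep (αs k)))) g p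
    have hq' : ∀ U : QRep Q (αs k),
        repEval U q = repEval (gAct g (dsum e (Function.update V k U))) p := by
      intro U
      have h1 := hq (MvPolynomial.aeval (repCoords U))
      have h2 : mapRep (MvPolynomial.aeval (repCoords U)) (dsum e (Function.update
          (fun i => mapRep (MvPolynomial.C (R := ℂ) (σ := RepCoord (Q := Q) (αs k))) (V i)) k
          (univRep (αs k)))) = dsum e (Function.update V k U) := by
        refine (mapRep_dsum e (MvPolynomial.eval (repCoords U)) _).trans
          (congrArg _ (funext fun i => ?_))
        by_cases hi : i = k
        · subst hi
          rw [Function.update_self, Function.update_self]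
          funext a
          ext r c
          exact MvPolynomial.eval_X _
        · rw [Function.update_of_ne hi, Function.update_of_ne hi]
          funext a
          ext r c
          exact MvPolynomial.eval_C _
      rw [h2] at h1
      exact h1
    have h3 : repEval (V k) q = 0 := by
      refine mem_zclosure_iff.1 (hVs k (Finset.mem_insert_self k s)) q fun U hU => ?_
      rw [hq']
      refine mem_zclosure_iff.1 (ih (Function.update V k U) (fun i hi => ?_) (fun i hi => ?_) g)
        p hp
      · rw [Function.update_of_ne (ne_of_mem_of_not_mem hi hk)]
        exact hVs i (Finset.mem_insert_of_mem hi)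
      · by_cases h : i = k
        · subst h
          rwa [Function.update_self]
        · rw [Function.update_of_ne h]
          exact hV i fun h' => (Finset.mem_insert.1 h').elim h hi
    rwa [hq', Function.update_eq_self] at h3

theorem zclosure_sumSet [Fintype ι] [Fintype Q.A] (c : ι → ℂ) :
    zclosure (sumSet αs (fun i => zclosure (lineSet (F i))) α) =
      zclosure (nfSet e F Finset.univ c) := by
  apply Set.Subset.antisymm
  · refine zclosure_minimal ?_ (zIsClosed_zclosure _)
    rintro W ⟨V, hV, hW⟩
    obtain ⟨g, rfl⟩ := mem_orbitOf_iff.2 ((isSumOf_iff_rIso e).1 hW)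
    exact gAct_dsum_mem_zclosure e F c Finset.univ V (fun i _ => hV i)
      (fun i hi => (hi (Finset.mem_univ i)).elim) g
  · refine zclosure_mono ?_
    rintro W ⟨μ, -, hW⟩
    exact ⟨_, fun i => subset_zclosure _ ⟨μ i, self_mem_orbitOf _⟩, (isSumOf_iff_rIso e).2 hW⟩

/-- A point avoiding a hypersurface, finitely many values of each coordinate, and finitely many
coincidences between coordinates. -/
theorem exists_generic_coordinates [Finite ι] (q : MvPolynomial ι ℂ) {μ₀ : ι → ℂ}
    (hq : MvPolynomial.eval μ₀ q ≠ 0) {r : ι → ι → ℂ → ℂ → Prop}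
    (hsymm : ∀ i j x y, r i j x y → r j i y x) {E : ι → Set ℂ} (s : Finset ι)
    (hE : ∀ i ∈ s, (E i).Finite) (hr : ∀ i ∈ s, ∀ j y, {x | r i j x y}.Finite) :
    ∃ μ, MvPolynomial.eval μ q ≠ 0 ∧ (∀ i ∉ s, μ i = μ₀ i) ∧ (∀ i ∈ s, μ i ∉ E i) ∧
      ∀ i ∈ s, ∀ j, j ≠ i → ¬ r i j (μ i) (μ j) := by
  induction s using Finset.induction_on with
  | empty => exact ⟨μ₀, hq, fun _ _ => rfl, by simp, by simp⟩
  | insert k s hk ih =>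
    obtain ⟨μ, h1, h2, h3, h4⟩ := ih (fun i hi => hE i (Finset.mem_insert_of_mem hi))
      (fun i hi => hr i (Finset.mem_insert_of_mem hi))
    let u : Polynomial ℂ := MvPolynomial.aeval
      (Function.update (fun i => Polynomial.C (μ i)) k Polynomial.X) q
    have hu : ∀ x, u.eval x = MvPolynomial.eval (Function.update μ k x) q := by
      intro x
      rw [← Polynomial.coe_aeval_eq_eval, ← MvPolynomial.coe_aeval_eq_eval]
      change Polynomial.aeval x (MvPolynomial.aeval _ q) = MvPolynomial.aeval _ q
      rw [← AlgHom.comp_apply, MvPolynomial.comp_aeval]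
      congr 2
      funext i
      by_cases hi : i = k
      · subst hi
        simp
      · simp [Function.update_of_ne hi]
    have hu0 : u ≠ 0 := by
      intro h0
      have := hu (μ k)
      rw [Function.update_eq_self, h0, Polynomial.eval_zero] at this
      exact h1 this.symm
    have hfin : (E k ∪ (⋃ j, {x | r k j x (μ j)}) ∪ u.rootSet ℂ).Finite :=
      ((hE k (Finset.mem_insert_self k s)).union (Set.finite_iUnion fun j =>
        hr k (Finset.mem_insert_self k s) j (μ j))).union (u.rootSet_finite ℂ)
    obtain ⟨x, hx⟩ := hfin.infinite_compl.nonempty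
    simp only [Set.mem_compl_iff, Set.mem_union, Set.mem_iUnion, not_or, not_exists] at hx
    obtain ⟨⟨hxE, hxr⟩, hxu⟩ := hx
    refine ⟨Function.update μ k x, ?_, fun i hi => ?_, fun i hi => ?_, fun i hi j hj => ?_⟩
    · rw [← hu]
      rwa [Polynomial.mem_rootSet_of_ne hu0, Polynomial.coe_aeval_eq_eval] at hxu
    · rw [Function.update_of_ne (ne_of_mem_of_not_mem (Finset.mem_insert_self k s) hi).symm]
      exact h2 i fun h => hi (Finset.mem_insert_of_mem h)
    · by_cases h : i = k
      · subst h
        rwa [Function.update_self]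
      · rw [Function.update_of_ne h]
        exact h3 i (Finset.mem_of_mem_insert_of_ne hi h)
    · by_cases h : i = k
      · subst h
        rw [Function.update_self, Function.update_of_ne hj]
        exact hxr j
      · rw [Function.update_of_ne h]
        by_cases h' : j = k
        · subst h'
          rw [Function.update_self]
          exact fun hrij => hxr i (hsymm _ _ _ _ hrij)
        · rw [Function.update_of_ne h']
          exact h4 i (Finset.mem_of_mem_insert_of_ne hi h) j hj

end SumFamilies

section SumDimension

variable {Q : Quiv} {ι : Type} [DecidableEq ι] {α : Q.V → ℕ} {αs : ι → Q.V → ℕ}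
  (e : ∀ x, (Σ i, Fin (αs i x)) ≃ Fin (α x)) (F : ∀ i, RepR Q (Polynomial ℂ) (αs i))

theorem zIrred_zclosure_nfSet [Fintype Q.A] (s : Finset ι) (c : ι → ℂ) :
    zIrred (zclosure (nfSet e F s c)) := by
  rw [nfSet_eq_famSet]
  exact zIrred_zclosure_famSet _

variable {F} {T : Finset ι}

theorem nfSet_univ_eq [Fintype ι]
    (hconst : ∀ i ∉ T, ∀ x y, polyEvalAt (F i) x = polyEvalAt (F i) y) (c : ι → ℂ) :
    nfSet e F Finset.univ c = nfSet e F T c := by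
  refine Set.Subset.antisymm ?_ (nfSet_mono e F (Finset.subset_univ T) c)
  rintro W ⟨μ, -, hW⟩
  refine ⟨fun i => if i ∈ T then μ i else c i, fun i hi => if_neg hi, ?_⟩
  have : nf e F (fun i => if i ∈ T then μ i else c i) = nf e F μ := by
    refine congrArg (dsum e) (funext fun i => ?_)
    by_cases hi : i ∈ T
    · simp only [if_pos hi]
    · exact hconst i hi _ _
  rwa [this]

theorem zclosure_nfSet_ssubset [Fintype ι] [Fintype Q.A]
    (hind : ∀ i, {x | ¬ IsIndecRep (polyEvalAt (F i) x)}.Finite)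
    (hfin : ∀ i ∈ T, ∀ (β : Q.V → ℕ) (V : QRep Q β), {x | RIso V (polyEvalAt (F i) x)}.Finite)
    {c : ι → ℂ} (hc : ∀ i, IsIndecRep (polyEvalAt (F i) (c i)))
    (hcr : ∀ i ∈ T, ∀ j, j ≠ i → ¬ RIso (polyEvalAt (F i) (c i)) (polyEvalAt (F j) (c j)))
    {s : Finset ι} {k : ι} (hk : k ∉ s) (hs : insert k s ⊆ T) :
    zclosure (nfSet e F s c) ⊂ zclosure (nfSet e F (insert k s) c) := by
  refine ⟨zclosure_mono (nfSet_mono e F (Finset.subset_insert k s) c), fun hsub => ?_⟩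
  obtain ⟨f, ⟨W₀, hW₀, hf₀⟩, hf⟩ := famSet_contains_open (nfSubfamily e F s c)
  rw [← nfSet_eq_famSet] at hW₀ hf
  obtain ⟨μ₀, hμ₀, hiso⟩ := hW₀
  obtain ⟨g, rfl⟩ := mem_orbitOf_iff.2 hiso
  obtain ⟨q, hq⟩ := exists_nf_pullback e F g f
  rw [← hq] at hf₀
  obtain ⟨μ, hμq, hμ, hμE, -⟩ := exists_generic_coordinates q hf₀ (r := fun _ _ _ _ => False)
    (by simp) (E := fun i => {x | ¬ IsIndecRep (polyEvalAt (F i) x)} ∪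
      {x | RIso (polyEvalAt (F k) (c k)) (polyEvalAt (F i) x)}) (insert k s)
    (fun i hi => (hind i).union (hfin i (hs hi) _ _)) (by simp)
  have hμc : ∀ i ∉ insert k s, μ i = c i := fun i hi =>
    (hμ i hi).trans (hμ₀ i fun h => hi (Finset.mem_insert_of_mem h))
  have hmem : gAct g (nf e F μ) ∈ nfSet e F (insert k s) c :=
    ⟨μ, hμc, mem_orbitOf_iff.1 ⟨g, rfl⟩⟩
  obtain ⟨μ', hμ', hiso'⟩ := hf _ (hsub (subset_zclosure _ hmem)) (by rwa [← hq])
  have hiso'' : RIso (nf e F μ') (nf e F μ) :=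
    hiso'.trans (RIso.symm (mem_orbitOf_iff.1 ⟨g, rfl⟩))
  obtain ⟨j, hj⟩ := exists_rIso_of_rIso_dsum e k (fun i => by
    by_cases hi : i ∈ insert k s
    · exact not_not.1 fun h => hμE i hi (Or.inl h)
    · rw [hμc i hi]
      exact hc i) hiso'' (by
    rw [hμ' k hk]
    exact hc k)
  rw [hμ' k hk] at hj
  by_cases hjs : j ∈ insert k s
  · exact hμE j hjs (Or.inr hj)
  · rw [hμc j hjs] at hj
    exact hcr k (hs (Finset.mem_insert_self k s)) j
      (fun h => hjs (h ▸ Finset.mem_insert_self k s)) hj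

theorem dRank_add_card_le_zdim [Fintype ι] [Fintype Q.A]
    (hind : ∀ i, {x | ¬ IsIndecRep (polyEvalAt (F i) x)}.Finite)
    (hfin : ∀ i ∈ T, ∀ (β : Q.V → ℕ) (V : QRep Q β), {x | RIso V (polyEvalAt (F i) x)}.Finite)
    {c : ι → ℂ} (hc : ∀ i, IsIndecRep (polyEvalAt (F i) (c i)))
    (hcr : ∀ i ∈ T, ∀ j, j ≠ i → ¬ RIso (polyEvalAt (F i) (c i)) (polyEvalAt (F j) (c j)))
    (s : Finset ι) (hs : s ⊆ T) :
    (dRank (nf e F c) : WithBot ℕ∞) + (s.card : WithBot ℕ∞) ≤ zdim (zclosure (nfSet e F s c)) := by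
  induction s using Finset.induction_on with
  | empty =>
    rw [Finset.card_empty, Nat.cast_zero, add_zero, ← zdim_orbitOf]
    refine zdim_mono (Set.Subset.trans ?_ (subset_zclosure _))
    intro W hW
    exact ⟨c, fun _ _ => rfl, mem_orbitOf_iff.1 hW⟩
  | insert k s hk ih =>
    rw [Finset.card_insert_of_notMem hk, Nat.cast_succ, ← add_assoc]
    exact (add_le_add_left (ih ((Finset.subset_insert k s).trans hs)) 1).trans
      (zdim_add_one_le (zIrred_zclosure_nfSet e F s c) (zIsClosed_zclosure _)
        (zIrred_zclosure_nfSet e F _ c) (zclosure_nfSet_ssubset e hind hfin hc hcr hk hs))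

theorem exists_dRank_max [Fintype Q.A] {X : Set (QRep Q α)} (hX : X.Nonempty) :
    ∃ V ∈ X, ∀ W ∈ X, dRank W ≤ dRank V := by
  have hb : BddAbove (dRank '' X) := by
    refine ⟨Fintype.card (RepCoord (Q := Q) α), ?_⟩
    rintro _ ⟨W, -, rfl⟩
    exact (Submodule.finrank_le _).trans (Module.finrank_pi ℂ).le
  obtain ⟨V, hV, h⟩ := Nat.sSup_mem (hX.image dRank) hb
  exact ⟨V, hV, fun W hW => (le_csSup hb ⟨W, hW, rfl⟩).trans h.ge⟩

theorem zdim_zclosure_nfSet [Fintype ι] [Fintype Q.A]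
    (hind : ∀ i, {x | ¬ IsIndecRep (polyEvalAt (F i) x)}.Finite)
    (hfin : ∀ i ∈ T, ∀ (β : Q.V → ℕ) (V : QRep Q β), {x | RIso V (polyEvalAt (F i) x)}.Finite)
    (hconst : ∀ i ∉ T, ∀ x y, polyEvalAt (F i) x = polyEvalAt (F i) y) (c₀ : ι → ℂ) :
    zdim (zclosure (nfSet e F Finset.univ c₀)) =
      sSup {d : WithBot ℕ∞ | ∃ V ∈ zclosure (nfSet e F Finset.univ c₀), d = zdim (orbitOf V)} +
        (T.card : WithBot ℕ∞) := by
  obtain ⟨V₀, hV₀, hmax⟩ := exists_dRank_max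
    ⟨_, subset_zclosure _ (mem_nfSet_self e F Finset.univ c₀)⟩
  obtain ⟨p, hp, hpr⟩ := exists_poly_le_dRank V₀
  obtain ⟨_, ⟨μ₀, -, hiso⟩, hp₁⟩ := (zIsOpen_ne p).inter_nonempty_of_zclosure hV₀ hp
  obtain ⟨g, rfl⟩ := mem_orbitOf_iff.2 hiso
  obtain ⟨q, hq⟩ := exists_nf_pullback e F g p
  have hq₀ : MvPolynomial.eval μ₀ q ≠ 0 := by
    rw [hq]
    exact hp₁
  obtain ⟨c, hcq, -, hcE, hcr⟩ := exists_generic_coordinates q hq₀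
    (r := fun i j x y => RIso (polyEvalAt (F i) x) (polyEvalAt (F j) y))
    (fun _ _ _ _ h => h.symm) (E := fun i => {x | ¬ IsIndecRep (polyEvalAt (F i) x)}) T
    (fun i _ => hind i) (fun i hi j y => (hfin i hi _ (polyEvalAt (F j) y)).subset
      fun x hx => RIso.symm hx)
  have hc : ∀ i, IsIndecRep (polyEvalAt (F i) (c i)) := by
    intro i
    by_cases hi : i ∈ T
    · exact not_not.1 (hcE i hi)
    · obtain ⟨x, hx⟩ := (hind i).infinite_compl.nonempty
      rw [hconst i hi (c i) x]
      exact not_not.1 hx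
  have huniv : ∀ s c', nfSet e F s c' ⊆ nfSet e F Finset.univ c₀ := fun s c' W ⟨μ, _, hW⟩ =>
    ⟨μ, fun i hi => (hi (Finset.mem_univ i)).elim, hW⟩
  have hX : zclosure (nfSet e F Finset.univ c₀) = zclosure (nfSet e F T c) := by
    rw [← nfSet_univ_eq e hconst]
    refine congrArg zclosure (Set.Subset.antisymm ?_ (huniv _ _))
    exact fun W ⟨μ, _, hW⟩ => ⟨μ, fun i hi => (hi (Finset.mem_univ i)).elim, hW⟩
  have hcX : nf e F c ∈ zclosure (nfSet e F Finset.univ c₀) :=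
    subset_zclosure _ (huniv ∅ c (mem_nfSet_self e F ∅ c))
  have hrank : dRank (nf e F c) = dRank V₀ := by
    refine le_antisymm (hmax _ hcX) ?_
    rw [RIso.dRank_eq (mem_orbitOf_iff.1 ⟨g, rfl⟩ : RIso (nf e F c) (gAct g (nf e F c)))]
    exact hpr _ (by
      rw [hq] at hcq
      exact hcq)
  have hsup : sSup {d : WithBot ℕ∞ | ∃ V ∈ zclosure (nfSet e F Finset.univ c₀),
      d = zdim (orbitOf V)} = (dRank V₀ : WithBot ℕ∞) := by
    refine IsGreatest.csSup_eq ⟨⟨V₀, hV₀, (zdim_orbitOf V₀).symm⟩, ?_⟩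
    rintro _ ⟨V, hV, rfl⟩
    rw [zdim_orbitOf]
    exact_mod_cast hmax V hV
  rw [hsup]
  apply le_antisymm
  · rw [hX, nfSet_eq_famSet, ← Fintype.card_coe T]
    refine zdim_zclosure_famSet_le _ fun c' => hmax _ (subset_zclosure _ (huniv T c ?_))
    rw [nfSet_eq_famSet]
    exact ⟨c', self_mem_orbitOf _⟩
  · rw [hX, ← hrank]
    exact dRank_add_card_le_zdim e hind hfin hc hcr T subset_rfl

end SumDimension
/-- Let `A = ℂQ/⟨R⟩` be a connected, acyclic, tame bound quiver algebra,
`α` a dimension vector with `P_A(α) ≠ ∅`, and `C(α) = closure(C(α₁) ⊕ ⋯ ⊕ C(α_l))` the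
generic decomposition of `C(α)`.  Then the number of generic parameters
`μ_g(C(α)) = dim C(α) − max{dim GL(α)·V : V ∈ C(α)}` equals the number `t` of indices `i`
(counting multiplicity) for which `C(α_i)` is not an orbit closure; equivalently,
`dim C(α) = max{dim GL(α)·V} + t`. -/
theorem statement14 (Q : Quiv) [Fintype Q.A] (hconn : QConnected Q) (hacyc : QAcyclic Q)
    (R : Set (FormalRel Q)) (hRfin : R.Finite) (hRadm : AdmissibleRels R)
    (htame : IsTame R)
    (α : Q.V → ℕ) (hne : (PAset R α).Nonempty)
    (l : ℕ) (αs : Fin l → (Q.V → ℕ))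
    (hsum : ∀ x, α x = ∑ i, αs i x)
    (hnei : ∀ i, (PAset R (αs i)).Nonempty)
    (hindec : ∀ i, IsIndecComp (Cset R (αs i)) (modSet R (αs i)))
    (hdec : Cset R α = zclosure (sumSet αs (fun i => Cset R (αs i)) α)) :
    zdim (Cset R α) =
      sSup {d : WithBot ℕ∞ | ∃ V ∈ Cset R α, d = zdim (orbitOf V)} +
        ((Nat.card {i : Fin l // ¬ IsOrbitClosure R (Cset R (αs i))} : ℕ∞) : WithBot ℕ∞) := by
  classical
  have hF : ∀ i, ∃ F : RepR Q (Polynomial ℂ) (αs i), Cset R (αs i) = zclosure (lineSet F) ∧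
      (¬ IsOrbitClosure R (Cset R (αs i)) →
        ∀ V : QRep Q (αs i), {x | RIso V (polyEvalAt F x)}.Finite) ∧
      (IsOrbitClosure R (Cset R (αs i)) → ∀ x y, polyEvalAt F x = polyEvalAt F y) := by
    intro i
    by_cases h : IsOrbitClosure R (Cset R (αs i))
    · obtain ⟨V, -, hV⟩ := id h
      refine ⟨mapRep Polynomial.C V, by rw [lineSet_map_C, hV], fun h' => (h' h).elim,
        fun _ x y => ?_⟩
      rw [polyEvalAt_map_C, polyEvalAt_map_C]
    · obtain ⟨F, hF, hfin⟩ := exists_family_of_isTame htame (hindec i) h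
      exact ⟨F, hF, fun _ => hfin, fun h' => (h h').elim⟩
  choose F hCF hfin hconst using hF
  let e : ∀ x, (Σ i, Fin (αs i x)) ≃ Fin (α x) := fun x =>
    Fintype.equivFinOfCardEq (by rw [Fintype.card_sigma, hsum x]; simp)
  let T : Finset (Fin l) := Finset.univ.filter fun i => ¬ IsOrbitClosure R (Cset R (αs i))
  have hX : Cset R α = zclosure (nfSet e F Finset.univ 0) := by
    rw [hdec, ← zclosure_sumSet]
    simp only [← hCF]
  have hcard : Nat.card {i : Fin l // ¬ IsOrbitClosure R (Cset R (αs i))} = T.card := by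
    rw [Nat.card_eq_fintype_card, Fintype.card_subtype]
  rw [hcard, hX]
  refine zdim_zclosure_nfSet e (T := T) (fun i => ?_) (fun i hi β V => ?_) (fun i hi => ?_) 0
  · refine finite_not_isIndecRep (M := modSet R (αs i)) ?_
    rw [← hCF]
    exact hindec i
  · rcases Set.eq_empty_or_nonempty {x | RIso V (polyEvalAt (F i) x)} with h | ⟨x, hx⟩
    · rw [h]
      exact Set.finite_empty
    · exact (hfin i (Finset.mem_filter.1 hi).2 (polyEvalAt (F i) x)).subset
        fun y hy => (RIso.symm hx).trans hy
  · refine hconst i (not_not.1 fun h => hi ?_)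
    exact Finset.mem_filter.2 ⟨Finset.mem_univ i, h⟩
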